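/- Given a Turing machine M, an input word w, and a number n encoded in unary, one can construct in polynomial time a Turing machine M′ whose size is polynomial in ‖M‖, |w| and n, such that M′ is ‖M′‖-space-bounded (on every input it halts using at most ‖M′‖ space), and: if M accepts w using at most n space, then M′ accepts on the empty input, and otherwise M′ rejects on the empty input. -/

import Mathlib

/-!
STATEMENT 16: Given a Turing machine M, an input word w, and a number n
encoded in unary, one can construct in polynomial time a Turing machine M′
whose size is polynomial in ‖M‖, |w| and n, such that M′ is ‖M′‖-space-bounded
(on every input it halts using at most ‖M′‖ space), and: if M accepts w using
at most n space, then M′ accepts on the empty input, and otherwise M′ rejects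
on the empty input.  (The machine M is assumed, w.l.o.g., to always halt.)

Machines are encoded over the two-letter alphabet Bool; ‖M‖ is the length of
the encoding of M.  "Constructible in polynomial time" is rendered by the
existence of a polynomial-time computable function g on encodings which maps
the encoding of the triple (M, w, n) to the encoding of the constructed
machine M′ = F M w n.
-/

/-- A tape symbol: `none` is the blank symbol. -/
abbrev TapeSym := Option Bool

/-- A deterministic one-tape Turing machine with tape alphabet `TapeSym`
(inputs are binary words).  `trans q a = none` means the machine halts;
`trans q a = some (q', b, d)` means: write `b`, move right if `d` and left
otherwise, and go to state `q'`. -/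
structure TM where
  nstates : ℕ
  q0 : Fin nstates
  qacc : Fin nstates
  trans : Fin nstates → TapeSym → Option (Fin nstates × TapeSym × Bool)

/-- A configuration of a one-tape Turing machine. -/
structure TMCfg (M : TM) where
  q : Fin M.nstates
  tape : ℤ → TapeSym
  pos : ℤ

/-- The (deterministic) one-step function; `none` means the machine has halted. -/
def TM.stepCfg (M : TM) (c : TMCfg M) : Option (TMCfg M) :=
  match M.trans c.q (c.tape c.pos) with
  | none => none
  | some (q', a, d) =>
      some ⟨q', Function.update c.tape c.pos a, if d then c.pos + 1 else c.pos - 1⟩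

/-- The initial configuration on input word `w`. -/
def TM.initCfg (M : TM) (w : List Bool) : TMCfg M :=
  ⟨M.q0, fun i => if i < 0 then none else w[i.toNat]?, 0⟩

/-- The configuration after `n` steps on input `w` (`none` if the machine has
halted before). -/
def TM.run (M : TM) (w : List Bool) : ℕ → Option (TMCfg M)
  | 0 => some (M.initCfg w)
  | n + 1 => (M.run w n).bind M.stepCfg

/-- `M` halts on input `w`. -/
def TM.Halts (M : TM) (w : List Bool) : Prop :=
  ∃ (n : ℕ) (c : TMCfg M), M.run w n = some c ∧ M.stepCfg c = none

/-- `M` halts on `w` in the accepting state. -/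
def TM.Accepts (M : TM) (w : List Bool) : Prop :=
  ∃ (n : ℕ) (c : TMCfg M), M.run w n = some c ∧ M.stepCfg c = none ∧ c.q = M.qacc

/-- `M` halts on `w` in a non-accepting state. -/
def TM.Rejects (M : TM) (w : List Bool) : Prop :=
  ∃ (n : ℕ) (c : TMCfg M), M.run w n = some c ∧ M.stepCfg c = none ∧ c.q ≠ M.qacc

/-- `M` uses at most `s` tape cells on input `w`: all head positions along the
run lie in an interval of length `s`. -/
def TM.RunsInSpace (M : TM) (w : List Bool) (s : ℕ) : Prop :=
  ∃ lo : ℤ, ∀ (n : ℕ) (c : TMCfg M), M.run w n = some c →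
    lo ≤ c.pos ∧ c.pos < lo + s

/-- `M` is a polynomial-space Turing machine. -/
def TM.PolySpace (M : TM) : Prop :=
  ∃ p : Polynomial ℕ, ∀ w : List Bool, M.RunsInSpace w (Polynomial.eval w.length p)

/-- `M` decides the language `L` (halting on every input). -/
def TM.Decides (M : TM) (L : Set (List Bool)) : Prop :=
  ∀ w : List Bool, ∃ (n : ℕ) (c : TMCfg M),
    M.run w n = some c ∧ M.stepCfg c = none ∧ (c.q = M.qacc ↔ w ∈ L)

/-- `M` decides `L` within time `T` (in the length of the input). -/
def TM.DecidesInTime (M : TM) (L : Set (List Bool)) (T : ℕ → ℕ) : Prop :=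
  ∀ w : List Bool, ∃ (n : ℕ) (c : TMCfg M), n ≤ T w.length ∧
    M.run w n = some c ∧ M.stepCfg c = none ∧ (c.q = M.qacc ↔ w ∈ L)

/-- `M` computes the word function `f` within time `T`: on input `w` it halts
after at most `T |w|` steps with `f w` written on the tape starting at
position 0 (followed by blanks). -/
def TM.ComputesInTime (M : TM) (f : List Bool → List Bool) (T : ℕ → ℕ) : Prop :=
  ∀ w : List Bool, ∃ (n : ℕ) (c : TMCfg M), n ≤ T w.length ∧
    M.run w n = some c ∧ M.stepCfg c = none ∧
    ∀ i : ℕ, c.tape (i : ℤ) = (f w)[i]?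

/-- `f` is computable in polynomial time. -/
def PolyTimeComputable (f : List Bool → List Bool) : Prop :=
  ∃ (M : TM) (p : Polynomial ℕ), M.ComputesInTime f fun n => Polynomial.eval n p

/-- `L₁` reduces to `L₂` in polynomial time. -/
def PolyTimeReducible (L₁ L₂ : Set (List Bool)) : Prop :=
  ∃ f : List Bool → List Bool, PolyTimeComputable f ∧ ∀ w, w ∈ L₁ ↔ f w ∈ L₂

/-- The class P of polynomial-time decidable languages. -/
def InP (L : Set (List Bool)) : Prop :=
  ∃ (M : TM) (p : Polynomial ℕ), M.DecidesInTime L fun n => Polynomial.eval n p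

/-- The class PSPACE of languages decidable by polynomial-space deterministic
Turing machines. -/
def InPSpace (L : Set (List Bool)) : Prop :=
  ∃ M : TM, M.PolySpace ∧ M.Decides L

/-- `L` is PSPACE-hard (w.r.t. polynomial-time reductions). -/
def PSpaceHard (L : Set (List Bool)) : Prop :=
  ∀ L' : Set (List Bool), InPSpace L' → PolyTimeReducible L' L

/-- `L` is PSPACE-complete. -/
def PSpaceComplete (L : Set (List Bool)) : Prop :=
  InPSpace L ∧ PSpaceHard L

/-- Unary encoding of a natural number (used as a self-delimiting prefix). -/
def encodeNatU (n : ℕ) : List Bool := List.replicate n true ++ [false]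

/-- Encoding of a tape symbol. -/
def encodeSym : TapeSym → List Bool
  | none => [false, false]
  | some b => [true, b]

/-- Encoding of one entry of the transition table. -/
def encodeEntry {k : ℕ} : Option (Fin k × TapeSym × Bool) → List Bool
  | none => [false]
  | some (q, a, d) => true :: (encodeNatU q.val ++ encodeSym a ++ [d])

/-- Encoding of a Turing machine over the two-letter alphabet `Bool`. -/
def encodeTM (M : TM) : List Bool :=
  encodeNatU M.nstates ++ encodeNatU M.q0.val ++ encodeNatU M.qacc.val ++
    ((List.finRange M.nstates).map fun q =>
      (([none, some false, some true].map fun a => encodeEntry (M.trans q a)).flatten)).flatten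

/-- The size `‖M‖` of a Turing machine: the length of its encoding. -/
def TM.size (M : TM) : ℕ := (encodeTM M).length

/-- Encoding of the input triple (M, w, n) with n in unary. -/
def encodeInput (M : TM) (w : List Bool) (n : ℕ) : List Bool :=
  encodeTM M ++ (encodeNatU w.length ++ w) ++ encodeNatU n


/-! ## Generic reachability -/

/-- `Rch f P t c c'`: iterating `f` from `c` reaches `c'` in at most `t` steps, and all
visited configurations satisfy `P`. -/
inductive Rch {C : Type} (f : C → Option C) (P : C → Prop) : ℕ → C → C → Prop
  | refl (t : ℕ) (c : C) : P c → Rch f P t c c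
  | step (t : ℕ) (c c' c'' : C) : P c → f c = some c' → Rch f P t c' c'' → Rch f P (t + 1) c c''

theorem Rch.mono {C : Type} {f : C → Option C} {P : C → Prop} {t : ℕ} {c c' : C}
    (h : Rch f P t c c') : ∀ {t' : ℕ}, t ≤ t' → Rch f P t' c c' := by
  induction h with
  | refl t c h => intro t' _; exact Rch.refl _ _ h
  | step t c c' c'' h1 h2 _ ih =>
    intro t' ht
    obtain ⟨u, rfl⟩ : ∃ u, t' = u + 1 := ⟨t' - 1, by omega⟩
    exact Rch.step _ _ _ _ h1 h2 (ih (by omega))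

theorem Rch.weaken {C : Type} {f : C → Option C} {P P' : C → Prop} {t : ℕ} {c c' : C}
    (h : Rch f P t c c') (hP : ∀ c, P c → P' c) : Rch f P' t c c' := by
  induction h with
  | refl t c h => exact Rch.refl _ _ (hP _ h)
  | step t c c' c'' h1 h2 _ ih => exact Rch.step _ _ _ _ (hP _ h1) h2 ih

theorem Rch.trans {C : Type} {f : C → Option C} {P : C → Prop} {t u : ℕ} {c c' c'' : C}
    (h : Rch f P t c c') (h' : Rch f P u c' c'') : Rch f P (t + u) c c'' := by
  induction h with
  | refl t c h => exact h'.mono (by omega)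
  | step t c c1 c2 h1 h2 _ ih =>
    exact (Rch.step _ _ _ _ h1 h2 (ih h')).mono (by omega)

theorem Rch.head {C : Type} {f : C → Option C} {P : C → Prop} {t : ℕ} {c c' : C}
    (h : Rch f P t c c') : P c := by
  cases h <;> assumption

theorem Rch.last {C : Type} {f : C → Option C} {P : C → Prop} {t : ℕ} {c c' : C}
    (h : Rch f P t c c') : P c' := by
  induction h <;> assumption

/-- one step -/
theorem Rch.one {C : Type} {f : C → Option C} {P : C → Prop} {c c' : C}
    (h1 : P c) (h2 : f c = some c') (h3 : P c') : Rch f P 1 c c' :=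
  Rch.step _ _ _ _ h1 h2 (Rch.refl _ _ h3)

/-- Simulation: each step is simulated by at most `T` steps. -/
theorem Rch.sim {C D : Type} {f : C → Option C} {P : C → Prop} {f' : D → Option D} {P' : D → Prop}
    (F : C → D) (Inv : C → Prop) (T : ℕ)
    (hP : ∀ c, Inv c → P c → P' (F c))
    (hs : ∀ c c', Inv c → P c → f c = some c' → P c' → Inv c' ∧ Rch f' P' T (F c) (F c'))
    {t : ℕ} {c c' : C} (h : Rch f P t c c') (hc : Inv c) :
    Inv c' ∧ Rch f' P' (t * T) (F c) (F c') := by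
  induction h with
  | refl t c h => exact ⟨hc, Rch.refl _ _ (hP _ hc h)⟩
  | step t c c1 c2 h1 h2 h3 ih =>
    obtain ⟨hi, hr⟩ := hs _ _ hc h1 h2 h3.head
    obtain ⟨hi2, hr2⟩ := ih hi
    exact ⟨hi2, (hr.trans hr2).mono (by rw [Nat.succ_mul]; omega)⟩

/-! ## Register programs -/

inductive Prog
  | skip
  | rej
  | seq (p q : Prog)
  | push (i : ℕ) (b : Bool)
  | pop (i : ℕ) (p0 pf pt : Prog)
  | loop (i : ℕ) (pf pt : Prog)
  | unt (i : ℕ) (p : Prog)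

/-- continuation after popping `o` from the relevant register -/
def br : List Prog → Option Bool → List Prog
  | Prog.pop _ p0 _ _ :: K, none => p0 :: K
  | Prog.pop _ _ pf _ :: K, some false => pf :: K
  | Prog.pop _ _ _ pt :: K, some true => pt :: K
  | Prog.loop _ _ _ :: K, none => K
  | Prog.loop i pf pt :: K, some false => pf :: Prog.loop i pf pt :: K
  | Prog.loop i pf pt :: K, some true => pt :: Prog.loop i pf pt :: K
  | Prog.unt i p :: K, some true => p :: Prog.unt i p :: K
  | Prog.unt _ _ :: K, _ => K
  | K, _ => K

/-- pop from register `i` and continue -/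
def popStep (K : List Prog) (i : ℕ) (s : List (List Bool)) : Option (List Prog × List (List Bool)) :=
  match s[i]? with
  | none => none
  | some [] => some (br K none, s)
  | some (b :: x) => some (br K (some b), s.set i x)

/-- small-step semantics -/
def sstep : List Prog × List (List Bool) → Option (List Prog × List (List Bool))
  | ([], _) => none
  | (Prog.rej :: _, _) => none
  | (Prog.skip :: K, s) => some (K, s)
  | (Prog.seq p q :: K, s) => some (p :: q :: K, s)
  | (Prog.push i b :: K, s) =>
    match s[i]? with
    | none => none
    | some x => some (K, s.set i (b :: x))
  | (Prog.pop i p0 pf pt :: K, s) => popStep (Prog.pop i p0 pf pt :: K) i s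
  | (Prog.loop i pf pt :: K, s) => popStep (Prog.loop i pf pt :: K) i s
  | (Prog.unt i p :: K, s) => popStep (Prog.unt i p :: K) i s

/-- register index used by the first instruction -/
def idx : List Prog → ℕ
  | Prog.push i _ :: _ => i
  | Prog.pop i _ _ _ :: _ => i
  | Prog.loop i _ _ :: _ => i
  | Prog.unt i _ :: _ => i
  | _ => 0

/-- total size of the registers -/
def sz (s : List (List Bool)) : ℕ := (s.map List.length).sum

/-! ## The tape machine -/

inductive TS
  | scan (K : List Prog) (j : ℕ)
  | ins (K : List Prog) (j : ℕ) (c : TapeSym)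
  | fin (K : List Prog) (j : ℕ)
  | del (K : List Prog) (j : ℕ) (c : TapeSym)
  | ret (K : List Prog) (j : ℕ)

def startS (r : ℕ) (K : List Prog) : TS := TS.scan K (min (idx K) r)

def dret (r : ℕ) (K : List Prog) (j : ℕ) (y : TapeSym) : Option (TS × TapeSym × Bool) :=
  match y with
  | some a => some (TS.ret K j, some a, false)
  | none =>
    match j with
    | 0 => some (startS r K, none, true)
    | j + 1 => some (TS.ret K j, none, false)

def dpop (r : ℕ) (K : List Prog) (y : TapeSym) : Option (TS × TapeSym × Bool) :=
  match y with
  | none => some (TS.ret (br K none) (min (idx K) r), none, false)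
  | some a => some (TS.fin K (r - min (idx K) r), some a, true)

def dact (r : ℕ) (K : List Prog) (y : TapeSym) : Option (TS × TapeSym × Bool) :=
  match K with
  | [] => none
  | Prog.rej :: _ => none
  | Prog.skip :: K' => some (TS.ret K' 0, y, false)
  | Prog.seq p q :: K' => some (TS.ret (p :: q :: K') 0, y, false)
  | Prog.push i b :: K' =>
    some (TS.ins K' (r - min i r - (if y = none then 1 else 0)) y, some b, true)
  | Prog.pop i p0 pf pt :: K' => dpop r (Prog.pop i p0 pf pt :: K') y
  | Prog.loop i pf pt :: K' => dpop r (Prog.loop i pf pt :: K') y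
  | Prog.unt i p :: K' => dpop r (Prog.unt i p :: K') y

/-- transition function of the tape machine for `r` registers -/
def dl (r : ℕ) : TS → TapeSym → Option (TS × TapeSym × Bool)
  | TS.scan K 0, y => dact r K y
  | TS.scan K (j + 1), some a => some (TS.scan K (j + 1), some a, true)
  | TS.scan K (j + 1), none => some (TS.scan K j, none, true)
  | TS.ins K 0 c, _ => some (TS.ret K (r - 1), c, false)
  | TS.ins K (j + 1) c, y => some (TS.ins K (j + 1 - (if y = none then 1 else 0)) y, c, true)
  | TS.fin K 0, _ => some (TS.del K (r - min (idx K) r) none, none, false)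
  | TS.fin K (j + 1), some a => some (TS.fin K (j + 1), some a, true)
  | TS.fin K (j + 1), none => some (TS.fin K j, none, true)
  | TS.del K j c, some a => some (TS.del K j (some a), c, false)
  | TS.del K (j + 1) c, none => some (TS.del K j none, c, false)
  | TS.del K 0 c, none => dret r (br K c) (min (idx K) r) none
  | TS.ret K j, y => dret r K j y

structure GC (Q : Type) where
  q : Q
  tape : ℤ → TapeSym
  pos : ℤ

def gstep {Q : Type} (d : Q → TapeSym → Option (Q × TapeSym × Bool)) (c : GC Q) : Option (GC Q) :=
  match d c.q (c.tape c.pos) with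
  | none => none
  | some (q', a, d) =>
      some ⟨q', Function.update c.tape c.pos a, if d then c.pos + 1 else c.pos - 1⟩

/-- tape whose cells from `-1` on are given by a list -/
def tapeOf (C : List TapeSym) (i : ℤ) : TapeSym :=
  if i < -1 then none else C.getD (i + 1).toNat none

theorem tapeOf_pad (C : List TapeSym) : tapeOf (C ++ [none]) = tapeOf C := by
  funext i
  unfold tapeOf
  split
  · rfl
  · simp only [List.getD_eq_getElem?_getD, List.getElem?_append]
    split
    · rfl
    · rename_i h
      rw [List.getElem?_eq_none (by omega : C.length ≤ _)]
      rcases Nat.eq_zero_or_pos ((i + 1).toNat - C.length) with h | h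
      · rw [h]; rfl
      · rw [List.getElem?_eq_none (by simp; omega)]

theorem tapeOf_pads (C : List TapeSym) (n : ℕ) :
    tapeOf (C ++ List.replicate n none) = tapeOf C := by
  induction n with
  | zero => simp
  | succ n ih => rw [List.replicate_succ', ← List.append_assoc, tapeOf_pad, ih]

/-- zipper configuration -/
def zc (q : TS) (l r : List TapeSym) : GC TS := ⟨q, tapeOf (l.reverse ++ r), (l.length : ℤ) - 1⟩

theorem zc_pad (q : TS) (l r : List TapeSym) : zc q l (r ++ [none]) = zc q l r := by
  unfold zc; rw [← List.append_assoc, tapeOf_pad]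

theorem tapeOf_read (l r : List TapeSym) (y : TapeSym) :
    tapeOf (l ++ y :: r) ((l.length : ℤ) - 1) = y := by
  unfold tapeOf
  rw [if_neg (by omega)]
  simp

theorem tapeOf_write (l r : List TapeSym) (y z : TapeSym) :
    Function.update (tapeOf (l ++ y :: r)) ((l.length : ℤ) - 1) z = tapeOf (l ++ z :: r) := by
  funext i
  by_cases h : i = (l.length : ℤ) - 1
  · subst h; rw [Function.update_self, tapeOf_read]
  · rw [Function.update_of_ne h]
    unfold tapeOf
    split
    · rfl
    · have : (i + 1).toNat ≠ l.length := by omega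
      simp only [List.getD_eq_getElem?_getD, List.getElem?_append]
      split
      · rfl
      · obtain ⟨k, hk⟩ : ∃ k, (i + 1).toNat - l.length = k + 1 :=
          ⟨(i + 1).toNat - l.length - 1, by omega⟩
        rw [hk]; rfl

theorem z_right {r : ℕ} {q q' : TS} {y z : TapeSym} (l rr : List TapeSym)
    (h : dl r q y = some (q', z, true)) :
    gstep (dl r) (zc q l (y :: rr)) = some (zc q' (z :: l) rr) := by
  have h1 := tapeOf_read l.reverse rr y
  have h2 := tapeOf_write l.reverse rr y z
  rw [List.length_reverse] at h1 h2
  simp only [gstep, zc, h1, h, h2]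
  simp

/-- zipper with the head on the first symbol of the second argument -/
def zl (q : TS) : List TapeSym → List TapeSym → GC TS
  | [], r => zc q [] (none :: r)
  | y :: l, r => zc q l (y :: r)

theorem z_left {r : ℕ} {q q' : TS} {y z : TapeSym} (l rr : List TapeSym) (hl : l ≠ [])
    (h : dl r q y = some (q', z, false)) :
    gstep (dl r) (zc q l (y :: rr)) = some (zl q' l (z :: rr)) := by
  have h1 := tapeOf_read l.reverse rr y
  have h2 := tapeOf_write l.reverse rr y z
  rw [List.length_reverse] at h1 h2
  cases l with
  | nil => exact absurd rfl hl
  | cons a l =>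
    simp only [gstep, zc, zl, h1, h, h2]
    simp

abbrev TR (r H : ℕ) : ℕ → GC TS → GC TS → Prop :=
  Rch (gstep (dl r)) (fun c => -1 ≤ c.pos ∧ c.pos ≤ H)

theorem zc_ok {q : TS} {l rr : List TapeSym} {H : ℕ} (h : l.length ≤ H + 1) :
    -1 ≤ (zc q l rr).pos ∧ (zc q l rr).pos ≤ H := by
  simp only [zc]; omega

theorem zl_ok {q : TS} {l rr : List TapeSym} {H : ℕ} (h : l.length ≤ H + 1) :
    -1 ≤ (zl q l rr).pos ∧ (zl q l rr).pos ≤ H := by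
  cases l with
  | nil => simp only [zl, zc]; simp
  | cons a l => simp only [zl, zc]; simp at h; omega

theorem tr_right {r H t : ℕ} {q q' : TS} {y z : TapeSym} {l rr : List TapeSym} {c : GC TS}
    (hl : l.length ≤ H + 1) (h : dl r q y = some (q', z, true))
    (h' : TR r H t (zc q' (z :: l) rr) c) : TR r H (t + 1) (zc q l (y :: rr)) c :=
  Rch.step _ _ _ _ (zc_ok hl) (z_right l rr h) h'

theorem tr_left {r H t : ℕ} {q q' : TS} {y z : TapeSym} {l rr : List TapeSym} {c : GC TS}
    (hl : l.length ≤ H + 1) (hne : l ≠ []) (h : dl r q y = some (q', z, false))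
    (hnext : TR r H t (zl q' l (z :: rr)) c) : TR r H (t + 1) (zc q l (y :: rr)) c :=
  Rch.step _ _ _ _ (zc_ok hl) (z_left l rr hne h) hnext

/-- layout of the registers on the tape -/
def lay : List (List Bool) → List TapeSym
  | [] => []
  | x :: xs => x.map some ++ none :: lay xs

theorem lay_append (a b : List (List Bool)) : lay (a ++ b) = lay a ++ lay b := by
  induction a with
  | nil => rfl
  | cons x a ih => simp [lay, ih]

theorem lay_length (a : List (List Bool)) : (lay a).length = sz a + a.length := by
  induction a with
  | nil => rfl
  | cons x a ih => simp [lay, ih, sz] at *; omega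

theorem lay_count (a : List (List Bool)) : (lay a).count none = a.length := by
  induction a with
  | nil => rfl
  | cons x a ih =>
    have : (x.map (some : Bool → TapeSym)).count none = 0 := by
      rw [List.count_eq_zero]; simp
    simp [lay, ih, List.count_append, this]

theorem lay_last (x : List Bool) (a : List (List Bool)) : ∃ zs, lay (x :: a) = zs ++ [none] := by
  induction a generalizing x with
  | nil => exact ⟨x.map some, rfl⟩
  | cons y a ih =>
    obtain ⟨zs, h⟩ := ih y
    exact ⟨x.map some ++ none :: zs, by rw [lay, h]; simp⟩

theorem tr_scan (r H : ℕ) (K : List Prog) (xs : List (List Bool)) : ∀ (l rr : List TapeSym),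
    l.length + (lay xs).length ≤ H + 1 →
    TR r H (lay xs).length (zc (TS.scan K xs.length) l (lay xs ++ rr))
      (zc (TS.scan K 0) ((lay xs).reverse ++ l) rr) := by
  induction xs with
  | nil => intro l rr h; exact Rch.refl _ _ (zc_ok (by simpa [lay] using h))
  | cons x xs ih =>
    induction x with
    | nil =>
      intro l rr h
      have h' : (none :: l).length + (lay xs).length ≤ H + 1 := by simp [lay] at h ⊢; omega
      have := tr_right (by simp at h'; omega : l.length ≤ H + 1)
        (show dl r (TS.scan K (xs.length + 1)) none = _ from rfl) (ih (none :: l) rr h')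
      simpa [lay] using this
    | cons b x ihx =>
      intro l rr h
      have h' : (some b :: l).length + (lay (x :: xs)).length ≤ H + 1 := by simp [lay] at h ⊢; omega
      have := tr_right (by simp at h'; omega : l.length ≤ H + 1)
        (show dl r (TS.scan K (xs.length + 1)) (some b) = _ from rfl) (ihx (some b :: l) rr h')
      simpa [lay] using this

theorem tr_fin (r H : ℕ) (K : List Prog) (xs : List (List Bool)) : ∀ (l rr : List TapeSym),
    l.length + (lay xs).length ≤ H + 1 →
    TR r H (lay xs).length (zc (TS.fin K xs.length) l (lay xs ++ rr))
      (zc (TS.fin K 0) ((lay xs).reverse ++ l) rr) := by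
  induction xs with
  | nil => intro l rr h; exact Rch.refl _ _ (zc_ok (by simpa [lay] using h))
  | cons x xs ih =>
    induction x with
    | nil =>
      intro l rr h
      have h' : (none :: l).length + (lay xs).length ≤ H + 1 := by simp [lay] at h ⊢; omega
      have := tr_right (by simp at h'; omega : l.length ≤ H + 1)
        (show dl r (TS.fin K (xs.length + 1)) none = _ from rfl) (ih (none :: l) rr h')
      simpa [lay] using this
    | cons b x ihx =>
      intro l rr h
      have h' : (some b :: l).length + (lay (x :: xs)).length ≤ H + 1 := by simp [lay] at h ⊢; omega
      have := tr_right (by simp at h'; omega : l.length ≤ H + 1)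
        (show dl r (TS.fin K (xs.length + 1)) (some b) = _ from rfl) (ihx (some b :: l) rr h')
      simpa [lay] using this

theorem tr_ret (r H : ℕ) (K : List Prog) (rl : List TapeSym) : ∀ (rr : List TapeSym),
    rl.length ≤ H →
    TR r H (rl.length + 1) (zl (TS.ret K (rl.count none)) (rl ++ [none]) rr)
      (zc (startS r K) [none] (rl.reverse ++ rr)) := by
  induction rl with
  | nil =>
    intro rr _
    exact Rch.one (zl_ok (by simp)) (z_right (q := TS.ret K 0) (y := none) [] rr rfl) (zc_ok (by simp))
  | cons y rl ih =>
    intro rr h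
    simp only [List.length_cons] at h
    have := tr_left (r := r) (H := H) (q := TS.ret K ((y :: rl).count none))
        (q' := TS.ret K (rl.count none))
        (y := y) (z := y) (l := rl ++ [none]) (rr := rr) (by simp; omega) (by simp)
        (by cases y <;> simp [dl, dret]) (ih (y :: rr) (by omega))
    simpa [zl] using this

theorem tr_ins (r H : ℕ) (K : List Prog) (y0 : TapeSym) (ys : List TapeSym) :
    ∀ (c : TapeSym) (zs l rr : List TapeSym), l ≠ [] → c :: ys = zs ++ [none] →
    l.length + ys.length ≤ H + 1 →
    TR r H (ys.length + 1) (zc (TS.ins K (ys.count none) c) l (ys ++ y0 :: rr))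
      (zl (TS.ret K (r - 1)) (zs.reverse ++ l) (none :: rr)) := by
  induction ys with
  | nil =>
    intro c zs l rr hl h hH
    cases zs with
    | nil =>
      simp at h; subst h
      exact Rch.one (zc_ok (by simpa using hH)) (z_left (q := TS.ins K 0 none) (y := y0) l rr hl rfl)
        (zl_ok (by simpa using hH))
    | cons z zs => simp at h
  | cons y ys ih =>
    intro c zs l rr hl h hH
    cases zs with
    | nil => simp at h
    | cons z zs =>
      simp only [List.cons_append, List.cons.injEq] at h
      obtain ⟨rfl, h⟩ := h
      simp only [List.length_cons] at hH
      have h3 : none ∈ y :: ys := by rw [h]; simp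
      have h4 := List.count_pos_iff.2 h3
      obtain ⟨k, hk⟩ : ∃ k, (y :: ys).count none = k + 1 := ⟨_, (Nat.succ_pred_eq_of_pos h4).symm⟩
      have h5 : k + 1 - (if y = none then 1 else 0) = ys.count none := by
        rw [← hk, List.count_cons]; cases y <;> simp
      have := tr_right (r := r) (H := H) (q := TS.ins K (k + 1) c) (q' := TS.ins K (ys.count none) y)
          (y := y) (z := c) (l := l) (rr := ys ++ y0 :: rr) (by omega) (by simp [dl, h5])
        (ih y zs (c :: l) rr (by simp) h (by simp; omega))
      rw [hk]
      simpa using this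

theorem tr_del (r H : ℕ) (K : List Prog) (l : List TapeSym) (rl : List TapeSym) :
    ∀ (c e : TapeSym) (zs rr : List TapeSym), c :: rl = zs ++ [e] →
    l.length + rl.length ≤ H →
    TR r H rl.length (zl (TS.del K (rl.count none) c) (rl ++ none :: l) rr)
      (zl (TS.del K 0 e) (none :: l) (zs.reverse ++ rr)) := by
  induction rl with
  | nil =>
    intro c e zs rr h hH
    cases zs with
    | nil =>
      simp at h; subst h
      exact Rch.refl _ _ (zl_ok (by simp at hH ⊢; omega))
    | cons z zs => simp at h
  | cons y rl ih =>
    intro c e zs rr h hH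
    cases zs with
    | nil => simp at h
    | cons z zs =>
      simp only [List.cons_append, List.cons.injEq] at h
      obtain ⟨rfl, h⟩ := h
      simp only [List.length_cons] at hH
      have := tr_left (r := r) (H := H) (q := TS.del K ((y :: rl).count none) c)
          (q' := TS.del K (rl.count none) y) (y := y) (z := c) (l := rl ++ none :: l) (rr := rr)
          (by simp; omega) (by simp) (by cases y <;> simp [dl])
        (ih y e zs (c :: rr) h (by omega))
      simpa [zl] using this

theorem tr_start (r H : ℕ) (K : List Prog) (pre post : List (List Bool)) (hi : idx K = pre.length)
    (hr : pre.length ≤ r) (hH : (lay pre).length ≤ H) :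
    TR r H (lay pre).length (zc (startS r K) [none] (lay (pre ++ post)))
      (zc (TS.scan K 0) ((lay pre).reverse ++ [none]) (lay post)) := by
  have := tr_scan r H K pre [none] (lay post) (by simp; omega)
  rw [startS, hi, min_eq_left hr, lay_append]
  exact this

theorem tr_pop_nil (r H : ℕ) (K : List Prog) (pre post : List (List Bool)) (hi : idx K = pre.length)
    (hr : pre.length + 1 + post.length = r) (hH : (lay (pre ++ [] :: post)).length ≤ H)
    (hK : ∀ y, dact r K y = dpop r K y) :
    TR r H (4 * (lay (pre ++ [] :: post)).length + 8)
      (zc (startS r K) [none] (lay (pre ++ [] :: post)))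
      (zc (startS r (br K none)) [none] (lay (pre ++ [] :: post))) := by
  have hlen : (lay (pre ++ [] :: post)).length = (lay pre).length + 1 + (lay post).length := by
    simp [lay_append, lay]; omega
  have h1 := tr_start r H K pre ([] :: post) hi (by omega) (by omega)
  have h3 := tr_ret r H (br K none) (lay pre).reverse (none :: lay post) (by simp; omega)
  rw [List.count_reverse, lay_count] at h3
  have h2 := tr_left (r := r) (H := H) (q := TS.scan K 0) (y := none) (z := none)
    (l := (lay pre).reverse ++ [none]) (rr := lay post) (by simp; omega) (by simp)
    (by simp only [dl, hK, dpop]; rw [hi, min_eq_left (by omega)]) h3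
  have := (h1.trans h2).mono (t' := 4 * (lay (pre ++ [] :: post)).length + 8) (by simp; omega)
  simpa [lay_append, lay] using this

theorem tr_pop_cons (r H : ℕ) (K : List Prog) (pre post : List (List Bool)) (b : Bool) (x : List Bool)
    (hi : idx K = pre.length)
    (hr : pre.length + 1 + post.length = r) (hH : (lay (pre ++ (b :: x) :: post)).length ≤ H)
    (hK : ∀ y, dact r K y = dpop r K y) :
    TR r H (4 * (lay (pre ++ (b :: x) :: post)).length + 8)
      (zc (startS r K) [none] (lay (pre ++ (b :: x) :: post)))
      (zc (startS r (br K (some b))) [none] (lay (pre ++ x :: post))) := by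
  have hlen : (lay (pre ++ (b :: x) :: post)).length
      = (lay pre).length + 1 + (lay (x :: post)).length := by
    simp [lay_append, lay]; omega
  have hmin : min (idx K) r = pre.length := by rw [hi, min_eq_left (by omega)]
  have hsub : r - pre.length = (x :: post).length := by simp; omega
  have h1 := tr_start r H K pre ((b :: x) :: post) hi (by omega) (by omega)
  -- the return sweep
  have h6 := tr_ret r H (br K (some b)) (lay pre).reverse (lay (x :: post) ++ [none] ++ [none])
    (by simp; omega)
  rw [List.count_reverse, lay_count] at h6
  obtain ⟨l', hl'⟩ : ∃ l', (lay pre).reverse ++ [none] = none :: l' := by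
    cases pre with
    | nil => exact ⟨[], rfl⟩
    | cons a pre =>
      obtain ⟨zs, h⟩ := lay_last a pre
      rw [h]; exact ⟨zs.reverse ++ [none], by simp⟩
  have hl'len : l'.length = (lay pre).length := by
    have := congrArg List.length hl'; simp at this; omega
  have h6' : TR r H ((lay pre).reverse.length + 1)
      (zl (TS.del K 0 (some b)) ((lay pre).reverse ++ [none]) (lay (x :: post) ++ [none] ++ [none]))
      (zc (startS r (br K (some b))) [none] (lay pre ++ (lay (x :: post) ++ [none] ++ [none]))) := by
    rw [List.reverse_reverse] at h6
    rw [hl'] at h6 ⊢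
    have hg : gstep (dl r) (zl (TS.ret (br K (some b)) pre.length) (none :: l')
          (lay (x :: post) ++ [none] ++ [none]))
        = gstep (dl r) (zl (TS.del K 0 (some b)) (none :: l') (lay (x :: post) ++ [none] ++ [none])) := by
      have hh := tapeOf_read l'.reverse (lay (x :: post) ++ [none] ++ [none]) none
      rw [List.length_reverse] at hh
      simp only [gstep, zl, zc, hh, dl, hmin]
    generalize hc : zl (TS.ret (br K (some b)) pre.length) (none :: l')
          (lay (x :: post) ++ [none] ++ [none]) = c0 at h6 hg
    generalize hd : zc (startS r (br K (some b))) [none] (lay pre ++ (lay (x :: post) ++ [none] ++ [none]))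
       = d0 at h6 ⊢
    cases h6 with
    | refl =>
      exfalso
      rw [← hd] at hc
      have := congrArg GC.pos hc
      have h2 := congrArg GC.q hc
      simp [zl, zc, startS] at h2
    | step t c c' c'' a1 a2 a3 =>
      refine Rch.step _ _ _ _ (zl_ok (by simp; omega)) ?_ a3
      rw [← hg, a2]
  -- the deletion sweep
  have h5 := tr_del r H K l' ((lay (x :: post)).reverse ++ [some b]) none (some b)
    (none :: (lay (x :: post)).reverse) [none] (by simp) (by simp; omega)
  rw [List.count_append, List.count_reverse, lay_count, ← hl'] at h5
  have h56 := h5.trans (by simpa using h6')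
  have h4 := tr_left (r := r) (H := H) (q := TS.fin K 0) (y := none) (z := none)
    (q' := TS.del K ((x :: post).length + List.count none [some b]) none)
    (l := (lay (x :: post)).reverse ++ [some b] ++ ((lay pre).reverse ++ [none])) (rr := [])
    (by simp; omega) (by simp)
    (by simp [dl, hmin]; omega) h56
  have h3 := tr_fin r H K (x :: post) (some b :: ((lay pre).reverse ++ [none])) [none]
    (by simp; omega)
  have h34 := h3.trans (by simpa using h4)
  have h2 := tr_right (r := r) (H := H) (q := TS.scan K 0) (y := some b) (z := some b)
    (l := (lay pre).reverse ++ [none]) (rr := lay (x :: post) ++ [none]) (by simp; omega)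
    (by simp only [dl, hK, dpop]; rw [hmin, hsub]) h34
  have e1 : some b :: (lay (x :: post) ++ [none]) = lay ((b :: x) :: post) ++ [none] := by simp [lay]
  rw [e1, zc_pad] at h2
  have := (h1.trans h2).mono (t' := 4 * (lay (pre ++ (b :: x) :: post)).length + 8)
    (by omega)
  have e2 : ∀ q, zc q [none] (lay pre ++ (lay (x :: post) ++ [none, none]))
      = zc q [none] (lay (pre ++ x :: post)) := by
    intro q
    have : lay pre ++ (lay (x :: post) ++ [none, none])
      = lay (pre ++ x :: post) ++ [none] ++ [none] := by simp [lay_append]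
    rw [this, zc_pad, zc_pad]
  rw [e2] at this
  exact this

theorem tr_push (r H : ℕ) (K : List Prog) (pre post : List (List Bool)) (b : Bool) (x : List Bool)
    (hr : pre.length + 1 + post.length = r) (hH : (lay (pre ++ x :: post)).length + 1 ≤ H) :
    TR r H (4 * (lay (pre ++ x :: post)).length + 8)
      (zc (startS r (Prog.push pre.length b :: K)) [none] (lay (pre ++ x :: post)))
      (zc (startS r K) [none] (lay (pre ++ (b :: x) :: post))) := by
  have hlen : (lay (pre ++ x :: post)).length
      = (lay pre).length + (lay (x :: post)).length := by
    simp [lay_append]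
  have h1 := tr_start r H (Prog.push pre.length b :: K) pre (x :: post) rfl (by omega) (by omega)
  obtain ⟨zs, hzs⟩ := lay_last x post
  obtain ⟨y, ys, hys⟩ : ∃ y ys, lay (x :: post) = y :: ys := by
    cases x with
    | nil => exact ⟨_, _, rfl⟩
    | cons a x => exact ⟨_, _, rfl⟩
  have hc := lay_count (x :: post)
  have hy : ys.length + 1 = (lay (x :: post)).length := by rw [hys]; rfl
  have hz : zs.length + 1 = (lay (x :: post)).length := by rw [hzs]; simp
  have hcz : zs.count none + 1 = post.length + 1 := by rw [hzs] at hc; simpa using hc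
  have h4 := tr_ret r H K (zs.reverse ++ some b :: (lay pre).reverse) [none] (by simp; omega)
  have hcount : (zs.reverse ++ some b :: (lay pre).reverse).count none = r - 1 := by
    simp [List.count_append, lay_count]; omega
  rw [hcount] at h4
  have h3 := tr_ins r H K none ys y zs (some b :: ((lay pre).reverse ++ [none])) [] (by simp)
    (by rw [← hys, hzs]) (by simp; omega)
  have h34 := h3.trans (by simpa using h4)
  have h2 := tr_right (r := r) (H := H) (q := TS.scan (Prog.push pre.length b :: K) 0) (y := y)
    (z := some b) (l := (lay pre).reverse ++ [none]) (rr := ys ++ [none]) (by simp; omega)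
    (by
      simp only [dl, dact]
      rw [min_eq_left (by omega)]
      have : r - pre.length - (if y = none then 1 else 0) = ys.count none := by
        have : r - pre.length = (y :: ys).count none := by rw [← hys, hc]; simp; omega
        rw [this, List.count_cons]; cases y <;> simp
      rw [this]) h34
  have e1 : y :: (ys ++ [none]) = lay (x :: post) ++ [none] := by simp [hys]
  rw [e1, zc_pad] at h2
  have := (h1.trans h2).mono (t' := 4 * (lay (pre ++ x :: post)).length + 8)
    (by omega)
  have e2 : lay pre ++ some b :: (zs ++ [none]) = lay (pre ++ (b :: x) :: post) := by
    rw [← hzs]; simp [lay_append, lay]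
  simpa [e2] using this

theorem tr_idle (r H : ℕ) (K K' : List Prog) (s : List (List Bool)) (hs : s ≠ [])
    (hi : idx K = 0) (hK : ∀ y, dact r K y = some (TS.ret K' 0, y, false)) :
    TR r H (4 * (lay s).length + 8)
      (zc (startS r K) [none] (lay s)) (zc (startS r K') [none] (lay s)) := by
  obtain ⟨y, ys, hys⟩ : ∃ y ys, lay s = y :: ys := by
    match s, hs with
    | [] :: s, _ => exact ⟨_, _, rfl⟩
    | (a :: x) :: s, _ => exact ⟨_, _, rfl⟩
  have h2 := tr_ret r H K' [] (lay s) (by simp)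
  rw [hys] at h2 ⊢
  have h1 := tr_left (r := r) (H := H) (q := TS.scan K 0) (y := y) (z := y)
    (l := [none]) (rr := ys) (by simp) (by simp) (by simp only [dl, hK]; rfl) h2
  rw [startS, hi]
  exact h1.mono (by simp)

theorem get_split {α : Type} {s : List α} {i : ℕ} {x : α} (h : s[i]? = some x) :
    ∃ pre post, s = pre ++ x :: post ∧ pre.length = i ∧
      ∀ y, s.set i y = pre ++ y :: post := by
  induction s generalizing i with
  | nil => simp at h
  | cons a s ih =>
    cases i with
    | zero => simp at h; subst h; exact ⟨[], s, rfl, rfl, fun y => rfl⟩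
    | succ i =>
      simp at h
      obtain ⟨pre, post, h1, h2, h3⟩ := ih h
      exact ⟨a :: pre, post, by rw [h1]; rfl, by simp [h2], fun y => by simp [h3]⟩

theorem tr_popStep (r H : ℕ) (K : List Prog) (s : List (List Bool)) (K' : List Prog)
    (s' : List (List Bool)) (h : popStep K (idx K) s = some (K', s')) (hr : s.length = r)
    (hH : sz s + r ≤ H) (hK : ∀ y, dact r K y = dpop r K y) :
    s'.length = r ∧ TR r H (4 * (lay s).length + 8)
      (zc (startS r K) [none] (lay s)) (zc (startS r K') [none] (lay s')) := by
  unfold popStep at h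
  split at h
  · cases h
  · rename_i h0
    obtain ⟨pre, post, h1, h2, -⟩ := get_split h0
    simp at h
    obtain ⟨rfl, rfl⟩ := h
    have := lay_length s
    refine ⟨hr, ?_⟩
    subst h1
    exact tr_pop_nil r H K pre post h2.symm (by rw [← hr]; simp; omega) (by omega) hK
  · rename_i b x h0
    obtain ⟨pre, post, h1, h2, h3⟩ := get_split h0
    simp [h3] at h
    obtain ⟨rfl, rfl⟩ := h
    have := lay_length s
    subst h1
    refine ⟨by simp at hr ⊢; omega, ?_⟩
    exact tr_pop_cons r H K pre post b x h2.symm (by rw [← hr]; simp; omega) (by omega) hK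

/-- One step of the register program is simulated by the tape machine. -/
theorem tr_step (r H : ℕ) (K : List Prog) (s : List (List Bool)) (K' : List Prog)
    (s' : List (List Bool)) (h : sstep (K, s) = some (K', s')) (hr : s.length = r) (hr0 : 1 ≤ r)
    (hH : sz s + r + 1 ≤ H) :
    s'.length = r ∧ TR r H (4 * (lay s).length + 8)
      (zc (startS r K) [none] (lay s)) (zc (startS r K') [none] (lay s')) := by
  have hs : s ≠ [] := by rintro rfl; simp at hr; omega
  match K with
  | [] => cases h
  | Prog.rej :: K => cases h
  | Prog.skip :: K =>
    simp [sstep] at h; obtain ⟨rfl, rfl⟩ := h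
    exact ⟨hr, tr_idle r H _ _ _ hs rfl (fun y => rfl)⟩
  | Prog.seq p q :: K =>
    simp [sstep] at h; obtain ⟨rfl, rfl⟩ := h
    exact ⟨hr, tr_idle r H _ _ _ hs rfl (fun y => rfl)⟩
  | Prog.push i b :: K =>
    simp only [sstep] at h
    split at h
    · cases h
    · rename_i x h0
      obtain ⟨pre, post, h1, h2, h3⟩ := get_split h0
      simp [h3] at h
      obtain ⟨rfl, rfl⟩ := h
      have := lay_length s
      subst h1 h2
      refine ⟨by simp at hr ⊢; omega, ?_⟩
      exact tr_push r H K pre post b x (by rw [← hr]; simp; omega) (by omega)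
  | Prog.pop i p0 pf pt :: K => exact tr_popStep r H _ s K' s' h hr (by omega) (fun y => rfl)
  | Prog.loop i pf pt :: K => exact tr_popStep r H _ s K' s' h hr (by omega) (fun y => rfl)
  | Prog.unt i p :: K => exact tr_popStep r H _ s K' s' h hr (by omega) (fun y => rfl)

theorem tr_run (r B : ℕ) (hr0 : 1 ≤ r) {t : ℕ} {K K' : List Prog} {s s' : List (List Bool)}
    (h : Rch sstep (fun c => sz c.2 ≤ B) t (K, s) (K', s')) (hr : s.length = r) :
    s'.length = r ∧ TR r (B + r + 1) (t * (4 * (B + r) + 8))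
      (zc (startS r K) [none] (lay s)) (zc (startS r K') [none] (lay s')) := by
  have := Rch.sim (f' := gstep (dl r)) (P' := fun c => -1 ≤ c.pos ∧ c.pos ≤ ((B + r + 1 : ℕ) : ℤ))
    (fun c : List Prog × List (List Bool) => zc (startS r c.1) [none] (lay c.2))
    (fun c => c.2.length = r) (4 * (B + r) + 8)
    (fun c _ _ => zc_ok (by simp))
    (fun c c' hi hP hs _ => by
      obtain ⟨a1, a2⟩ := tr_step r (B + r + 1) c.1 c.2 c'.1 c'.2 hs hi hr0 (by omega)
      refine ⟨a1, a2.mono ?_⟩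
      have := lay_length c.2
      omega) h hr
  exact this

/-! ## Finiteness of the set of states -/

/-- continuations occurring during the execution of a program -/
def cl : Prog → List Prog → Set (List Prog)
  | Prog.skip, K => {Prog.skip :: K}
  | Prog.rej, K => {Prog.rej :: K}
  | Prog.push i b, K => {Prog.push i b :: K}
  | Prog.seq p q, K => {Prog.seq p q :: K} ∪ (cl p (q :: K) ∪ cl q K)
  | Prog.pop i a b c, K => {Prog.pop i a b c :: K} ∪ (cl a K ∪ (cl b K ∪ cl c K))
  | Prog.loop i f t, K =>
    {Prog.loop i f t :: K} ∪ (cl f (Prog.loop i f t :: K) ∪ cl t (Prog.loop i f t :: K))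
  | Prog.unt i p, K => {Prog.unt i p :: K} ∪ cl p (Prog.unt i p :: K)

theorem cl_finite (p : Prog) : ∀ K, (cl p K).Finite := by
  induction p with
  | skip => intro K; simp [cl]
  | rej => intro K; simp [cl]
  | push i b => intro K; simp [cl]
  | seq p q hp hq => intro K; simp [cl, hp, hq]
  | pop i a b c ha hb hc => intro K; simp [cl, ha, hb, hc]
  | loop i f t hf ht => intro K; simp [cl, hf, ht]
  | unt i p hp => intro K; simp [cl, hp]

theorem cl_self (p : Prog) (K : List Prog) : p :: K ∈ cl p K := by
  cases p <;> simp [cl]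

/-- possible successor continuations -/
def Succ : List Prog → List Prog → Prop
  | [], _ => False
  | Prog.rej :: _, _ => False
  | Prog.skip :: K, K' => K' = K
  | Prog.push _ _ :: K, K' => K' = K
  | Prog.seq p q :: K, K' => K' = p :: q :: K
  | P :: K, K' => ∃ o, K' = br (P :: K) o

theorem cl_closed (p : Prog) : ∀ K L L', L ∈ cl p K → Succ L L' → L' = K ∨ L' ∈ cl p K := by
  induction p with
  | skip => intro K L L' h; simp [cl] at h; subst h; intro h; left; exact h
  | rej => intro K L L' h; simp [cl] at h; subst h; intro h; exact h.elim
  | push i b => intro K L L' h; simp [cl] at h; subst h; intro h; left; exact h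
  | seq p q hp hq =>
    intro K L L' h hs
    simp only [cl, Set.mem_union, Set.mem_singleton_iff] at h ⊢
    rcases h with rfl | h | h
    · rw [show L' = p :: q :: K from hs]
      exact Or.inr (Or.inr (Or.inl (cl_self _ _)))
    · rcases hp _ _ _ h hs with rfl | h
      · exact Or.inr (Or.inr (Or.inr (cl_self _ _)))
      · tauto
    · rcases hq _ _ _ h hs with rfl | h <;> tauto
  | pop i a b c ha hb hc =>
    intro K L L' h hs
    simp only [cl, Set.mem_union, Set.mem_singleton_iff] at h ⊢
    rcases h with rfl | h | h | h
    · have h1 := cl_self a K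
      have h2 := cl_self b K
      have h3 := cl_self c K
      obtain ⟨o, rfl⟩ := hs
      rcases o with _ | _ | _ <;> simp only [br] <;> tauto
    · rcases ha _ _ _ h hs with rfl | h <;> tauto
    · rcases hb _ _ _ h hs with rfl | h <;> tauto
    · rcases hc _ _ _ h hs with rfl | h <;> tauto
  | loop i f t hf ht =>
    intro K L L' h hs
    simp only [cl, Set.mem_union, Set.mem_singleton_iff] at h ⊢
    rcases h with rfl | h | h
    · have h1 := cl_self f (Prog.loop i f t :: K)
      have h2 := cl_self t (Prog.loop i f t :: K)
      obtain ⟨o, rfl⟩ := hs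
      rcases o with _ | _ | _ <;> simp only [br] <;> tauto
    · rcases hf _ _ _ h hs with rfl | h <;> tauto
    · rcases ht _ _ _ h hs with rfl | h <;> tauto
  | unt i p hp =>
    intro K L L' h hs
    simp only [cl, Set.mem_union, Set.mem_singleton_iff] at h ⊢
    rcases h with rfl | h
    · have h1 := cl_self p (Prog.unt i p :: K)
      obtain ⟨o, rfl⟩ := hs
      rcases o with _ | _ | _ <;> simp only [br] <;> tauto
    · rcases hp _ _ _ h hs with rfl | h <;> tauto

/-- all continuations of a closed program -/
def conts (p : Prog) : Set (List Prog) := insert [] (cl p [])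

theorem conts_closed (p : Prog) (L L' : List Prog) (h : L ∈ conts p) (hs : Succ L L') :
    L' ∈ conts p := by
  rcases h with rfl | h
  · exact hs.elim
  · exact cl_closed p _ _ _ h hs

def TS.K : TS → List Prog
  | TS.scan K _ => K
  | TS.ins K _ _ => K
  | TS.fin K _ => K
  | TS.del K _ _ => K
  | TS.ret K _ => K

def TS.j : TS → ℕ
  | TS.scan _ j => j
  | TS.ins _ j _ => j
  | TS.fin _ j => j
  | TS.del _ j _ => j
  | TS.ret _ j => j

def TS.isPop : TS → Prop
  | TS.fin K _ => ∀ o, Succ K (br K o)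
  | TS.del K _ _ => ∀ o, Succ K (br K o)
  | _ => True

/-- the finite set of states used by a program -/
def stateSet (p : Prog) (r : ℕ) : Set TS := {q | q.K ∈ conts p ∧ q.j ≤ r ∧ q.isPop}

theorem stateSet_finite (p : Prog) (r : ℕ) : (stateSet p r).Finite := by
  have hK : (conts p).Finite := (cl_finite p []).insert _
  have h1 : (conts p ×ˢ (Set.Iic r ×ˢ (Set.univ : Set (Option Bool)))).Finite :=
    hK.prod ((Set.finite_Iic r).prod Set.finite_univ)
  have h2 := ((h1.image (fun x => TS.scan x.1 x.2.1)).union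
    ((h1.image (fun x => TS.ins x.1 x.2.1 x.2.2)).union
    ((h1.image (fun x => TS.fin x.1 x.2.1)).union
    ((h1.image (fun x => TS.del x.1 x.2.1 x.2.2)).union
    (h1.image (fun x => TS.ret x.1 x.2.1))))))
  refine h2.subset ?_
  rintro q ⟨a1, a2, -⟩
  cases q with
  | scan K j => left; exact ⟨(K, j, none), ⟨a1, a2, trivial⟩, rfl⟩
  | ins K j c => right; left; exact ⟨(K, j, c), ⟨a1, a2, trivial⟩, rfl⟩
  | fin K j => right; right; left; exact ⟨(K, j, none), ⟨a1, a2, trivial⟩, rfl⟩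
  | del K j c => right; right; right; left; exact ⟨(K, j, c), ⟨a1, a2, trivial⟩, rfl⟩
  | ret K j => right; right; right; right; exact ⟨(K, j, none), ⟨a1, a2, trivial⟩, rfl⟩

theorem dret_closed {p : Prog} {r : ℕ} {K : List Prog} {j : ℕ} (hK : K ∈ conts p) (hj : j ≤ r)
    {y z : TapeSym} {q' : TS} {d : Bool} (h : dret r K j y = some (q', z, d)) :
    q' ∈ stateSet p r := by
  unfold dret at h
  split at h
  · simp at h; obtain ⟨rfl, -, -⟩ := h; exact ⟨hK, hj, trivial⟩
  · split at h
    · simp at h; obtain ⟨rfl, -, -⟩ := h; exact ⟨hK, by simp [startS, TS.j], trivial⟩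
    · simp at h; obtain ⟨rfl, -, -⟩ := h; exact ⟨hK, by simp only [TS.j]; omega, trivial⟩

theorem dpop_closed {p : Prog} {r : ℕ} {K : List Prog} (hK : K ∈ conts p)
    (hs : ∀ o, Succ K (br K o))
    {y z : TapeSym} {q' : TS} {d : Bool} (h : dpop r K y = some (q', z, d)) :
    q' ∈ stateSet p r := by
  unfold dpop at h
  split at h
  · simp at h; obtain ⟨rfl, -, -⟩ := h
    exact ⟨conts_closed p _ _ hK (hs none), by simp [TS.j], trivial⟩
  · simp at h; obtain ⟨rfl, -, -⟩ := h; exact ⟨hK, by simp [TS.j], hs⟩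

theorem dact_closed {p : Prog} {r : ℕ} {K : List Prog} (hK : K ∈ conts p)
    {y z : TapeSym} {q' : TS} {d : Bool} (h : dact r K y = some (q', z, d)) :
    q' ∈ stateSet p r := by
  unfold dact at h
  split at h
  · cases h
  · cases h
  · simp at h; obtain ⟨rfl, -, -⟩ := h
    exact ⟨conts_closed p _ _ hK rfl, by simp [TS.j], trivial⟩
  · simp at h; obtain ⟨rfl, -, -⟩ := h
    exact ⟨conts_closed p _ _ hK rfl, by simp [TS.j], trivial⟩
  · simp at h; obtain ⟨rfl, -, -⟩ := h
    exact ⟨conts_closed p _ _ hK rfl, by simp only [TS.j]; omega, trivial⟩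
  · exact dpop_closed hK (fun o => ⟨o, rfl⟩) h
  · exact dpop_closed hK (fun o => ⟨o, rfl⟩) h
  · exact dpop_closed hK (fun o => ⟨o, rfl⟩) h

theorem stateSet_closed (p : Prog) (r : ℕ) (q : TS) (hq : q ∈ stateSet p r) (y z : TapeSym) (q' : TS)
    (d : Bool) (h : dl r q y = some (q', z, d)) : q' ∈ stateSet p r := by
  obtain ⟨a1, a2, a3⟩ := hq
  unfold dl at h
  split at h
  · exact dact_closed a1 h
  · simp at h; obtain ⟨rfl, -, -⟩ := h; exact ⟨a1, a2, trivial⟩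
  · simp at h; obtain ⟨rfl, -, -⟩ := h; exact ⟨a1, by simp only [TS.j] at a2 ⊢; omega, trivial⟩
  · simp at h; obtain ⟨rfl, -, -⟩ := h; exact ⟨a1, by simp [TS.j], trivial⟩
  · simp at h; obtain ⟨rfl, -, -⟩ := h; exact ⟨a1, by simp only [TS.j] at a2 ⊢; omega, trivial⟩
  · simp at h; obtain ⟨rfl, -, -⟩ := h; exact ⟨a1, by simp [TS.j], a3⟩
  · simp at h; obtain ⟨rfl, -, -⟩ := h; exact ⟨a1, a2, a3⟩
  · simp at h; obtain ⟨rfl, -, -⟩ := h; exact ⟨a1, by simp only [TS.j] at a2 ⊢; omega, a3⟩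
  · simp at h; obtain ⟨rfl, -, -⟩ := h; exact ⟨a1, a2, a3⟩
  · simp at h; obtain ⟨rfl, -, -⟩ := h; exact ⟨a1, by simp only [TS.j] at a2 ⊢; omega, a3⟩
  · exact dret_closed (conts_closed p _ _ a1 (a3 _)) (by simp) h
  · exact dret_closed a1 a2 h

/-! ## From state sets to machines -/

theorem exists_tm {Q : Type} (N : ℕ) (d : Q → TapeSym → Option (Q × TapeSym × Bool)) (A : Set Q)
    (hA : A.Finite) (q0 qa : Q) (h0 : q0 ∈ A) :
    ∃ (M : TM) (e : Q → Fin M.nstates), N ≤ M.nstates ∧ M.q0 = e q0 ∧ M.qacc = e qa ∧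
      Set.InjOn e A ∧
      ∀ q ∈ A, ∀ y, M.trans (e q) y = (d q y).map (fun x => (e x.1, x.2.1, x.2.2)) := by
  classical
  have := hA.to_subtype
  obtain ⟨n, ⟨f⟩⟩ := Finite.exists_equiv_fin A
  let e0 : Q → Fin n := fun q => if h : q ∈ A then f ⟨q, h⟩ else f ⟨q0, h0⟩
  let e : Q → Fin (n + N) := fun q => Fin.castAdd N (e0 q)
  refine ⟨⟨n + N, e q0, e qa, fun i y => Fin.addCases (motive := fun _ => Option (Fin (n + N) × TapeSym × Bool))
      (fun i => (d (f.symm i).1 y).map (fun x => (e x.1, x.2.1, x.2.2))) (fun _ => none) i⟩,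
    e, by simp, rfl, rfl, ?_, ?_⟩
  · intro a ha b hb hab
    have hab := Fin.castAdd_injective _ _ hab
    simp only [e0, dif_pos ha, dif_pos hb] at hab
    have := f.injective hab
    exact congrArg Subtype.val this
  · intro q hq y
    have : (f.symm (e0 q)).1 = q := by simp [e0, dif_pos hq]
    simp only [e, Fin.addCases_left, this]

/-- transport of a reachability statement to a machine -/
theorem tm_rch {Q : Type} (d : Q → TapeSym → Option (Q × TapeSym × Bool)) (A : Set Q)
    (hcl : ∀ q ∈ A, ∀ y q' z b, d q y = some (q', z, b) → q' ∈ A)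
    (M : TM) (e : Q → Fin M.nstates)
    (he : ∀ q ∈ A, ∀ y, M.trans (e q) y = (d q y).map (fun x => (e x.1, x.2.1, x.2.2)))
    (lo hi : ℤ) {t : ℕ} {c c' : GC Q}
    (h : Rch (gstep d) (fun c => lo ≤ c.pos ∧ c.pos ≤ hi) t c c') (hc : c.q ∈ A) :
    c'.q ∈ A ∧ Rch M.stepCfg (fun c => lo ≤ c.pos ∧ c.pos ≤ hi) t
      ⟨e c.q, c.tape, c.pos⟩ ⟨e c'.q, c'.tape, c'.pos⟩ := by
  have := Rch.sim (f' := M.stepCfg) (P' := fun c => lo ≤ c.pos ∧ c.pos ≤ hi)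
    (fun c : GC Q => (⟨e c.q, c.tape, c.pos⟩ : TMCfg M)) (fun c => c.q ∈ A) 1
    (fun c _ h => h)
    (fun c c' hi hP hs hP' => by
      unfold gstep at hs
      split at hs
      · cases hs
      · rename_i q' a b hd
        simp only [Option.some.injEq] at hs
        subst hs
        refine ⟨hcl _ hi _ _ _ _ hd, Rch.one hP ?_ hP'⟩
        simp [TM.stepCfg, he _ hi, hd]) h hc
  simpa using this

theorem tm_stuck {Q : Type} (d : Q → TapeSym → Option (Q × TapeSym × Bool)) (A : Set Q)
    (M : TM) (e : Q → Fin M.nstates)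
    (he : ∀ q ∈ A, ∀ y, M.trans (e q) y = (d q y).map (fun x => (e x.1, x.2.1, x.2.2)))
    {c : GC Q} (hc : c.q ∈ A) (h : gstep d c = none) :
    M.stepCfg ⟨e c.q, c.tape, c.pos⟩ = none := by
  unfold gstep at h
  split at h
  · rename_i hd
    simp [TM.stepCfg, he _ hc, hd]
  · cases h

/-- iterated steps from a configuration -/
def itr (M : TM) (c : TMCfg M) : ℕ → Option (TMCfg M)
  | 0 => some c
  | n + 1 => (itr M c n).bind M.stepCfg

theorem itr_succ (M : TM) (c c' : TMCfg M) (h : M.stepCfg c = some c') (n : ℕ) :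
    itr M c (n + 1) = itr M c' n := by
  induction n with
  | zero => simp [itr, h]
  | succ n ih => rw [itr, ih]; rfl

theorem run_eq_itr (M : TM) (w : List Bool) (n : ℕ) : M.run w n = itr M (M.initCfg w) n := by
  induction n with
  | zero => rfl
  | succ n ih => rw [TM.run, ih]; rfl

theorem itr_of_rch (M : TM) {P : TMCfg M → Prop} {t : ℕ} {c c' : TMCfg M}
    (h : Rch M.stepCfg P t c c') (hs : M.stepCfg c' = none) :
    ∃ n ≤ t, itr M c n = some c' ∧ ∀ k d, itr M c k = some d → P d := by
  induction h with
  | refl t c h =>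
    refine ⟨0, by omega, rfl, ?_⟩
    intro k d hk
    cases k with
    | zero => simp [itr] at hk; subst hk; exact h
    | succ k =>
      have : ∀ k, itr M c (k + 1) = none := by
        intro k
        induction k with
        | zero => simp [itr, hs]
        | succ k ih => rw [itr, ih]; rfl
      rw [this] at hk; cases hk
  | step t c c1 c2 h1 h2 _ ih =>
    obtain ⟨n, a1, a2, a3⟩ := ih hs
    refine ⟨n + 1, by omega, by rw [itr_succ _ _ _ h2, a2], ?_⟩
    intro k d hk
    cases k with
    | zero => simp [itr] at hk; subst hk; exact h1
    | succ k => rw [itr_succ _ _ _ h2] at hk; exact a3 k d hk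

/-! ## Reasoning about programs -/

/-- executing `p` takes the registers from `s` to `s'` in at most `t` steps -/
def Ex (t : ℕ) (p : Prog) (s s' : List (List Bool)) : Prop :=
  ∀ K, Rch sstep (fun _ => True) t (p :: K, s) (K, s')

theorem sz_set (s : List (List Bool)) : ∀ (i : ℕ) (x y : List Bool), s[i]? = some x →
    sz (s.set i y) + x.length = sz s + y.length := by
  induction s with
  | nil => intro i x y h; simp at h
  | cons a s ih =>
    intro i x y h
    cases i with
    | zero => simp at h; subst h; simp [sz]; omega
    | succ i =>
      simp at h
      have := ih i x y h
      simp [sz] at this ⊢; omega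

theorem popStep_sz {K : List Prog} {i : ℕ} {s : List (List Bool)} {c'}
    (h : popStep K i s = some c') : sz c'.2 ≤ sz s := by
  unfold popStep at h
  split at h
  · cases h
  · cases h; exact le_rfl
  · rename_i b x hx
    cases h
    have := sz_set s i _ x hx
    simp at this ⊢; omega

theorem sstep_sz (c c' : List Prog × List (List Bool)) (h : sstep c = some c') :
    sz c'.2 ≤ sz c.2 + 1 := by
  obtain ⟨K, s⟩ := c
  match K with
  | [] => simp [sstep] at h
  | Prog.rej :: K => simp [sstep] at h
  | Prog.skip :: K => simp [sstep] at h; subst h; simp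
  | Prog.seq p q :: K => simp [sstep] at h; subst h; simp
  | Prog.push i b :: K =>
    simp only [sstep] at h
    split at h
    · cases h
    · rename_i x hx
      cases h
      have := sz_set s i _ (b :: x) hx
      simp at this ⊢; omega
  | Prog.pop i p0 pf pt :: K => exact (popStep_sz h).trans (by simp)
  | Prog.loop i pf pt :: K => exact (popStep_sz h).trans (by simp)
  | Prog.unt i p :: K => exact (popStep_sz h).trans (by simp)

theorem rch_sz {t : ℕ} {c c' : List Prog × List (List Bool)}
    (h : Rch sstep (fun _ => True) t c c') {B : ℕ} (hB : sz c.2 + t ≤ B) :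
    Rch sstep (fun c => sz c.2 ≤ B) t c c' := by
  induction h with
  | refl t c _ => exact Rch.refl _ _ (by omega)
  | step t c c1 c2 _ h2 _ ih =>
    have := sstep_sz _ _ h2
    exact Rch.step _ _ _ _ (by omega) h2 (ih (by omega))

theorem Ex.mono {t u : ℕ} {p s s'} (h : Ex t p s s') (hu : t ≤ u) : Ex u p s s' :=
  fun K => (h K).mono hu

theorem Ex.cast {t u : ℕ} {p s s' s''} (h : Ex t p s s') (hu : t ≤ u) (hs : s' = s'') :
    Ex u p s s'' := hs ▸ h.mono hu

theorem Ex.seq {t u : ℕ} {p q s s1 s2} (h : Ex t p s s1) (h' : Ex u q s1 s2) :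
    Ex (t + u + 1) (Prog.seq p q) s s2 :=
  fun _ => Rch.step _ _ _ _ trivial rfl ((h _).trans (h' _))

theorem Ex.skip (s) : Ex 1 Prog.skip s s := fun _ => Rch.one trivial rfl trivial

theorem Ex.push {i : ℕ} {b : Bool} {s : List (List Bool)} (x : List Bool) (h : s[i]? = some x) :
    Ex 1 (Prog.push i b) s (s.set i (b :: x)) :=
  fun _ => Rch.one trivial (by simp [sstep, h]) trivial

theorem Ex.pop_nil {t i : ℕ} {p0 pf pt} {s s' : List (List Bool)} (h : s[i]? = some [])
    (h' : Ex t p0 s s') : Ex (t + 1) (Prog.pop i p0 pf pt) s s' :=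
  fun K => Rch.step _ _ _ _ trivial (by simp only [sstep, popStep, h]; rfl) (h' K)

theorem Ex.pop_cons {t i : ℕ} {p0 pf pt} {b : Bool} {x : List Bool} {s s' : List (List Bool)}
    (h : s[i]? = some (b :: x))
    (h' : Ex t (cond b pt pf) (s.set i x) s') : Ex (t + 1) (Prog.pop i p0 pf pt) s s' :=
  fun K => Rch.step _ _ _ _ trivial (by simp only [sstep, popStep, h]; cases b <;> rfl) (h' K)

theorem Ex.loop_nil {i : ℕ} {pf pt} {s : List (List Bool)} (h : s[i]? = some []) :
    Ex 1 (Prog.loop i pf pt) s s :=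
  fun _ => Rch.one trivial (by simp only [sstep, popStep, h]; rfl) trivial

theorem Ex.loop_cons {t u i : ℕ} {pf pt} {b : Bool} {x : List Bool} {s s' s'' : List (List Bool)}
    (h : s[i]? = some (b :: x))
    (h' : Ex t (cond b pt pf) (s.set i x) s') (h'' : Ex u (Prog.loop i pf pt) s' s'') :
    Ex (t + u + 1) (Prog.loop i pf pt) s s'' :=
  fun K => Rch.step _ _ (cond b pt pf :: Prog.loop i pf pt :: K, s.set i x) _ trivial
    (by simp only [sstep, popStep, h]; cases b <;> rfl) ((h' _).trans (h'' K))

/-- loop rule; `G c x` is the state with consumed part `c` (reversed) and remaining part `x` -/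
theorem Ex.loop {t i : ℕ} {pf pt} (x0 : List Bool) (G : List Bool → List Bool → List (List Bool))
    (hG : ∀ c x, (G c x)[i]? = some x)
    (hb : ∀ c b x, x0 = c.reverse ++ b :: x → Ex t (cond b pt pf) ((G c (b :: x)).set i x) (G (b :: c) x)) :
    Ex ((t + 1) * x0.length + 1) (Prog.loop i pf pt) (G [] x0) (G x0.reverse []) := by
  suffices h : ∀ x c, x0 = c.reverse ++ x →
      Ex ((t + 1) * x.length + 1) (Prog.loop i pf pt) (G c x) (G x0.reverse []) from h x0 [] rfl
  intro x
  induction x with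
  | nil =>
    intro c hc
    have : x0.reverse = c := by rw [hc]; simp
    rw [this]
    exact (Ex.loop_nil (hG _ _)).mono (by simp)
  | cons b x ih =>
    intro c hc
    exact (Ex.loop_cons (hG _ _) (hb c b x hc) (ih (b :: c) (by rw [hc]; simp))).mono
      (by simp [Nat.mul_add]; omega)

/-- rule for unary numbers -/
theorem Ex.unt {t i : ℕ} {p} (n : ℕ) (y : List Bool) (G : ℕ → List Bool → List (List Bool))
    (hG : ∀ k x, (G k x)[i]? = some x)
    (hS : ∀ k x x', (G k x).set i x' = G k x')
    (hb : ∀ k x, Ex t p (G k x) (G (k + 1) x)) :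
    Ex ((t + 1) * n + 1) (Prog.unt i p) (G 0 (encodeNatU n ++ y)) (G n y) := by
  suffices h : ∀ n k,
      Ex ((t + 1) * n + 1) (Prog.unt i p) (G k (encodeNatU n ++ y)) (G (k + n) y) by
    simpa using h n 0
  intro n
  induction n with
  | zero =>
    intro k
    exact fun K => Rch.one trivial
      (by simp only [sstep, popStep, hG, encodeNatU, List.replicate_zero, List.nil_append,
        List.cons_append, hS]; rfl) trivial
  | succ n ih =>
    intro k K
    have h1 : sstep (Prog.unt i p :: K, G k (encodeNatU (n + 1) ++ y)) =
        some (p :: Prog.unt i p :: K, G k (encodeNatU n ++ y)) := by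
      simp only [sstep, popStep, hG, encodeNatU, List.replicate_succ,
        List.cons_append, hS]; rfl
    have h2 := Rch.step _ _ _ _ trivial h1 ((hb k _ _).trans (ih (k + 1) K))
    have : k + (n + 1) = k + 1 + n := by omega
    rw [this]
    exact h2.mono (by simp [Nat.mul_add]; omega)

/-- push a constant word -/
def pushes (i : ℕ) : List Bool → Prog
  | [] => Prog.skip
  | b :: l => Prog.seq (Prog.push i b) (pushes i l)

theorem Ex.pushes (i : ℕ) (l : List Bool) : ∀ {s : List (List Bool)} (x : List Bool),
    s[i]? = some x → Ex (2 * l.length + 1) (pushes i l) s (s.set i (l.reverse ++ x)) := by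
  induction l with
  | nil =>
    intro s x h
    have : s.set i x = s := by
      obtain ⟨hi, rfl⟩ := List.getElem?_eq_some_iff.1 h
      simp
    simpa [this, _root_.pushes] using Ex.skip s
  | cons b l ih =>
    intro s x h
    obtain ⟨hi, hx⟩ := List.getElem?_eq_some_iff.1 h
    have h2 := ih (s := s.set i (b :: x)) (b :: x) (by simp [hi])
    refine ((Ex.push x h).seq h2).cast (by simp; omega) (by simp)

/-! ## The generator program -/

/-- table entries of one writer state -/
def went (j : ℕ) (b : Bool) : List Bool :=
  true :: (List.replicate j true ++ [false, true, b, true, false, false])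

def wtab (k : ℕ) (x : List Bool) : List Bool :=
  (x.zipIdx.map fun p => went (k + p.2) p.1).flatten

theorem wtab_snoc (k : ℕ) (x : List Bool) (b : Bool) :
    wtab k (x ++ [b]) = wtab k x ++ went (k + x.length) b := by
  simp [wtab, List.zipIdx_append]

/-- move register `i` to register `j` (reversing) -/
def mv (i j : ℕ) : Prog := Prog.loop i (Prog.push j false) (Prog.push j true)

def wbody (b : Bool) : Prog :=
  Prog.seq (Prog.push 1 true)
  (Prog.seq (Prog.loop 3 Prog.skip (Prog.seq (Prog.push 1 true) (Prog.push 4 true)))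
  (Prog.seq (mv 4 3)
  (Prog.seq (pushes 1 [false, true, b, true, false, false]) (Prog.push 3 true))))

def pgen (c1 E : List Bool) (k : ℕ) : Prog :=
  Prog.seq (Prog.loop 0 (Prog.seq (Prog.push 2 false) (Prog.push 1 true))
    (Prog.seq (Prog.push 2 true) (Prog.push 1 true)))
  (Prog.seq (pushes 1 c1)
  (Prog.seq (mv 2 0)
  (Prog.seq (pushes 3 (List.replicate k true))
  (Prog.seq (Prog.loop 0 (wbody false) (wbody true))
  (Prog.seq (pushes 1 E)
  (Prog.seq (Prog.loop 3 Prog.skip Prog.skip) (mv 1 0)))))))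

theorem ex_wbody (b : Bool) (x o : List Bool) (j : ℕ) :
    Ex (10 * j + 30) (wbody b) [x, o, [], List.replicate j true, []]
      [x, (went j b).reverse ++ o, [], List.replicate (j + 1) true, []] := by
  have h1 : Ex 1 (Prog.push 1 true) [x, o, [], List.replicate j true, []]
      [x, true :: o, [], List.replicate j true, []] := Ex.push _ rfl
  have h2 : Ex (4 * j + 1) (Prog.loop 3 Prog.skip (Prog.seq (Prog.push 1 true) (Prog.push 4 true)))
      [x, true :: o, [], List.replicate j true, []]
      [x, List.replicate j true ++ true :: o, [], [], List.replicate j true] := by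
    have := Ex.loop (i := 3) (t := 3) (pf := Prog.skip) (pt := (Prog.seq (Prog.push 1 true) (Prog.push 4 true)))
      (List.replicate j true)
      (fun c y => [x, c ++ true :: o, [], y, c]) (fun _ _ => rfl) (by
        intro c b y h
        have : b = true := by
          have : b ∈ List.replicate j true := by rw [h]; simp
          exact List.eq_of_mem_replicate this
        subst this
        exact ((Ex.push (b := true) (i := 1) (c ++ true :: o) rfl).seq (Ex.push (i := 4) _ rfl)))
    simpa using this
  have h3 : Ex (2 * j + 1) (mv 4 3) [x, List.replicate j true ++ true :: o, [], [], List.replicate j true]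
     [x, List.replicate j true ++ true :: o, [], List.replicate j true, []] := by
    have := Ex.loop (i := 4) (t := 1) (pf := Prog.push 3 false) (pt := Prog.push 3 true)
      (List.replicate j true)
      (fun c y => [x, List.replicate j true ++ true :: o, [], c, y]) (fun _ _ => rfl) (by
        intro c b y h
        cases b <;> exact Ex.push _ rfl)
    simpa [mv] using this
  have h4 : Ex _ (pushes 1 [false, true, b, true, false, false])
     [x, List.replicate j true ++ true :: o, [], List.replicate j true, []] _ := Ex.pushes 1 _ _ rfl
  have h5 : Ex 1 (Prog.push 3 true) _ _ := Ex.push (s := [x, ([false, true, b, true, false, false] : List Bool).reverse ++ (List.replicate j true ++ true :: o), [], List.replicate j true, []]) _ rfl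
  refine (h1.seq (h2.seq (h3.seq (h4.seq h5)))).cast ?_ ?_
  · simp; omega
  · simp [went, List.replicate_succ]

theorem ex_pgen (c1 E : List Bool) (k : ℕ) (x : List Bool) :
    Ex ((10 * (k + x.length) + 31) * x.length + 30 * (x.length + k + c1.length + E.length) + 30 +
      2 * (wtab k x).length)
      (pgen c1 E k) [x, [], [], [], []]
      [List.replicate x.length true ++ c1 ++ wtab k x ++ E, [], [], [], []] := by
  have h1 := Ex.loop (i := 0) (t := 3) (pf := (Prog.seq (Prog.push 2 false) (Prog.push 1 true)))
    (pt := (Prog.seq (Prog.push 2 true) (Prog.push 1 true))) x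
    (fun c y => [y, List.replicate c.length true, c, [], []]) (fun _ _ => rfl) (by
      intro c b y h
      cases b
      · exact ((Ex.push (b := false) (i := 2) c rfl).seq (Ex.push (i := 1) _ rfl))
      · exact ((Ex.push (b := true) (i := 2) c rfl).seq (Ex.push (i := 1) _ rfl)))
  have h2 := Ex.pushes 1 c1 (s := [[], List.replicate x.reverse.length true, x.reverse, [], []]) _ rfl
  set o := c1.reverse ++ List.replicate x.reverse.length true with ho
  have h3 := Ex.loop (i := 2) (t := 1) (pf := Prog.push 0 false) (pt := Prog.push 0 true)
      x.reverse (fun c y => [c, o, y, [], []]) (fun _ _ => rfl) (by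
        intro c b y h
        cases b <;> exact Ex.push _ rfl)
  have h4 := Ex.pushes 3 (List.replicate k true) (s := [x.reverse.reverse, o, [], [], []]) _ rfl
  have h5 := Ex.loop (i := 0) (t := 10 * (k + x.length) + 30) (pf := wbody false) (pt := wbody true)
      x (fun c y => [y, (wtab k c.reverse).reverse ++ o, [], List.replicate (k + c.length) true, []])
      (fun _ _ => rfl) (by
        intro c b y h
        have hl : c.length ≤ x.length := by rw [h]; simp
        have := ex_wbody b y ((wtab k c.reverse).reverse ++ o) (k + c.length)
        have e : cond b (wbody true) (wbody false) = wbody b := by cases b <;> rfl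
        rw [e]
        refine this.cast (by omega) ?_
        simp [wtab_snoc, Nat.add_assoc])
  set o2 := (wtab k x.reverse.reverse).reverse ++ o
  have h6 := Ex.pushes 1 E (s := [[], o2, [], List.replicate (k + x.reverse.length) true, []]) _ rfl
  have h7 := Ex.loop (i := 3) (t := 1) (pf := Prog.skip) (pt := Prog.skip)
      (List.replicate (k + x.reverse.length) true) (fun c y => [[], E.reverse ++ o2, [], y, []]) (fun _ _ => rfl) (by
        intro c b y h
        cases b <;> exact Ex.skip _)
  have h8 := Ex.loop (i := 1) (t := 1) (pf := Prog.push 0 false) (pt := Prog.push 0 true)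
      (E.reverse ++ o2) (fun c y => [c, y, [], [], []]) (fun _ _ => rfl) (by
        intro c b y h
        cases b <;> exact Ex.push _ rfl)
  have e4 : ([x.reverse.reverse, o, [], [], []] : List (List Bool)).set 3 ((List.replicate k true).reverse ++ []) =
    [x, (wtab k ([] : List Bool).reverse).reverse ++ o, [], List.replicate (k + ([] : List Bool).length) true, []] := by
    simp [wtab]
  rw [e4] at h4
  refine (h1.seq (h2.seq (h3.seq (h4.seq (h5.seq (h6.seq (h7.seq h8))))))).cast ?_ ?_
  · simp [o2, ho]; ring_nf; omega
  · simp [o2, ho]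

theorem wtab_length (k : ℕ) (x : List Bool) :
    (wtab k x).length ≤ (k + x.length + 7) * x.length ∧ (k + 7) * x.length ≤ (wtab k x).length := by
  induction x using List.reverseRecOn with
  | nil => simp [wtab]
  | append_singleton x b ih =>
    rw [wtab_snoc]
    simp only [List.length_append, List.length_cons, List.length_nil, went, List.length_replicate]
    constructor
    · nlinarith [ih.1]
    · nlinarith [ih.2]

/-! ## Polynomial bounds -/

def PB (f : ℕ → ℕ) : Prop := ∃ p : Polynomial ℕ, ∀ m, f m ≤ p.eval m

theorem PB.const (c : ℕ) : PB (fun _ => c) := ⟨Polynomial.C c, by simp⟩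
theorem PB.id : PB (fun m => m) := ⟨Polynomial.X, by simp⟩
theorem PB.add {f g} (hf : PB f) (hg : PB g) : PB (fun m => f m + g m) := by
  obtain ⟨p, hp⟩ := hf
  obtain ⟨q, hq⟩ := hg
  exact ⟨p + q, fun m => by simpa using Nat.add_le_add (hp m) (hq m)⟩
theorem PB.mul {f g} (hf : PB f) (hg : PB g) : PB (fun m => f m * g m) := by
  obtain ⟨p, hp⟩ := hf
  obtain ⟨q, hq⟩ := hg
  exact ⟨p * q, fun m => by simpa using Nat.mul_le_mul (hp m) (hq m)⟩

/-! ## Register programs compute functions in polynomial time -/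

theorem startS_mem (p : Prog) (r : ℕ) (K : List Prog) (hK : K ∈ conts p) :
    startS r K ∈ stateSet p r := by
  refine ⟨hK, ?_, ?_⟩
  · simp [startS, TS.j]
  · simp [startS, TS.isPop]

theorem init_tape (w : List Bool) (k : ℕ) :
    (fun i : ℤ => if i < 0 then none else w[i.toNat]?) =
      tapeOf (none :: lay (w :: List.replicate k [])) := by
  funext i
  unfold tapeOf
  have hl : lay (w :: List.replicate k []) = w.map some ++ List.replicate (k + 1) none := by
    rw [lay]
    have : lay (List.replicate k []) = List.replicate k none := by
      induction k with
      | zero => rfl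
      | succ k ih => rw [List.replicate_succ, lay, ih]; simp [List.replicate_succ]
    rw [this]; simp [List.replicate_succ]
  rw [hl]
  by_cases h : i < -1
  · rw [if_pos (by omega), if_pos h]
  rw [if_neg h]
  by_cases h1 : i = -1
  · subst h1; simp
  rw [if_neg (by omega)]
  obtain ⟨n, rfl⟩ : ∃ n : ℕ, i = n := ⟨i.toNat, by omega⟩
  have : ((n : ℤ) + 1).toNat = n + 1 := by omega
  rw [this]
  simp only [Int.toNat_natCast, List.getD_eq_getElem?_getD, List.getElem?_cons_succ, List.getElem?_append,
    List.length_map, List.getElem?_map, List.getElem?_replicate]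
  split
  · rename_i h; simp [h]
  · rename_i h
    rw [List.getElem?_eq_none (by omega)]
    split <;> rfl

theorem polyTime_of_ex (k : ℕ) (p : Prog) (f : List Bool → List Bool) (T : ℕ → ℕ) (hT : PB T)
    (h : ∀ w, Ex (T w.length) p (w :: List.replicate k []) (f w :: List.replicate k [])) :
    PolyTimeComputable f := by
  have hK : ([p] : List Prog) ∈ conts p := Or.inr (cl_self p [])
  obtain ⟨M, e, -, hq0, -, -, htr⟩ := exists_tm 0 (dl (k + 1)) (stateSet p (k + 1))
    (stateSet_finite p (k + 1)) (startS (k + 1) [p]) (startS (k + 1) [p]) (startS_mem _ _ _ hK)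
  have hP : PB (fun m => T m * (4 * (m + T m + (k + 1)) + 8)) :=
    hT.mul (((PB.const 4).mul ((PB.id.add hT).add (PB.const (k + 1)))).add (PB.const 8))
  obtain ⟨P, hP⟩ := hP
  refine ⟨M, P, ?_⟩
  intro w
  have h1 := rch_sz (h w []) (B := w.length + T w.length) (by simp [sz])
  obtain ⟨-, h2⟩ := tr_run (k + 1) _ (by omega) h1 (by simp)
  obtain ⟨h3, h4⟩ := tm_rch _ (stateSet p (k + 1)) (fun q hq y q' z b hh => stateSet_closed p (k + 1) q hq y z q' b hh) M e htr _ _ h2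
    (startS_mem _ _ _ hK)
  have hst := tm_stuck _ _ M e htr h3 (by simp [gstep, zc, startS, idx, dl, dact])
  obtain ⟨n, hn, h5, -⟩ := itr_of_rch M h4 hst
  refine ⟨n, _, hn.trans (hP w.length), ?_, hst, ?_⟩
  · rw [run_eq_itr, ← h5]
    congr 1
    simp only [TM.initCfg, zc, hq0, init_tape w k]
    simp
  · intro i
    have := congrFun (init_tape (f w) k) i
    simp only [zc]
    simp at this ⊢
    exact this.symm

/-! ## The constructed machine -/

def Wtrans (U : TM) (x : List Bool) (i : Fin (U.nstates + (x.length + 1))) (y : TapeSym) :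
    Option (Fin (U.nstates + (x.length + 1)) × TapeSym × Bool) :=
  Fin.addCases (motive := fun _ => Option (Fin (U.nstates + (x.length + 1)) × TapeSym × Bool))
    (fun i => (U.trans i y).map fun z => (Fin.castAdd _ z.1, z.2.1, z.2.2))
    (fun i => match y with
      | some _ => none
      | none =>
        if h : i.1 < x.length then
          some (Fin.natAdd U.nstates ⟨i.1 + 1, by omega⟩, some (x[i.1]), true)
        else some (Fin.castAdd _ U.q0, none, false)) i

/-- writes `x` on the empty tape and starts `U` -/
def W (U : TM) (x : List Bool) : TM :=
  ⟨U.nstates + (x.length + 1), Fin.natAdd _ 0, Fin.castAdd _ U.qacc, Wtrans U x⟩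

theorem Wtrans_left (U : TM) (x : List Bool) (i : Fin U.nstates) (y : TapeSym) :
    Wtrans U x (Fin.castAdd _ i) y =
      (U.trans i y).map fun z => (Fin.castAdd _ z.1, z.2.1, z.2.2) := by
  simp only [Wtrans, Fin.addCases_left]

theorem Wtrans_some (U : TM) (x : List Bool) (i : Fin (x.length + 1)) (b : Bool) :
    Wtrans U x (Fin.natAdd _ i) (some b) = none := by
  simp only [Wtrans, Fin.addCases_right]

theorem Wtrans_none (U : TM) (x : List Bool) (i : Fin (x.length + 1)) (h : i.1 < x.length) :
    Wtrans U x (Fin.natAdd _ i) none =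
      some (Fin.natAdd U.nstates ⟨i.1 + 1, by omega⟩, some (x[i.1]), true) := by
  simp only [Wtrans, Fin.addCases_right, dif_pos h]

theorem Wtrans_last (U : TM) (x : List Bool) (i : Fin (x.length + 1)) (h : ¬ i.1 < x.length) :
    Wtrans U x (Fin.natAdd _ i) none = some (Fin.castAdd _ U.q0, none, false) := by
  simp only [Wtrans, Fin.addCases_right, dif_neg h]

def tabU (U : TM) : List Bool :=
  ((List.finRange U.nstates).map fun q =>
      (([none, some false, some true].map fun a => encodeEntry (U.trans q a)).flatten)).flatten

def constA (U : TM) : List Bool :=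
  List.replicate (U.nstates + 1) true ++ [false] ++ encodeNatU U.nstates ++ encodeNatU U.qacc.val ++ tabU U

def constE (U : TM) : List Bool :=
  true :: (encodeNatU U.q0.val ++ [false, false, false, false, false])

theorem encodeEntry_map {k k' : ℕ} (f : Fin k → Fin k') (hf : ∀ i, (f i).val = i.val)
    (o : Option (Fin k × TapeSym × Bool)) :
    encodeEntry (o.map fun z => (f z.1, z.2.1, z.2.2)) = encodeEntry o := by
  cases o with
  | none => rfl
  | some z => obtain ⟨q, a, d⟩ := z; simp [encodeEntry, hf]

theorem wtab_eq (k : ℕ) (x : List Bool) :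
    wtab k x = (List.ofFn fun i : Fin x.length => went (k + i.1) (x[i.1])).flatten := by
  unfold wtab
  congr 1
  apply List.ext_getElem
  · simp
  · intro i h1 h2
    simp

theorem encode_W (U : TM) (x : List Bool) :
    encodeTM (W U x) = List.replicate x.length true ++ constA U ++ wtab (U.nstates + 1) x ++ constE U := by
  have h0 : encodeTM (W U x) = encodeNatU (U.nstates + (x.length + 1)) ++ encodeNatU U.nstates ++
      encodeNatU U.qacc.val ++ ((List.finRange (U.nstates + (x.length + 1))).map fun q =>
      (([none, some false, some true].map fun a => encodeEntry (Wtrans U x q a)).flatten)).flatten := by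
    simp [encodeTM, W]
  have h1 : encodeNatU (U.nstates + (x.length + 1)) =
      List.replicate x.length true ++ (List.replicate (U.nstates + 1) true ++ [false]) := by
    have : U.nstates + (x.length + 1) = x.length + (U.nstates + 1) := by omega
    rw [encodeNatU, this, List.replicate_add, List.append_assoc]
  rw [h0, h1, ← List.ofFn_eq_map, List.ofFn_add, List.flatten_append, List.ofFn_succ_last,
    List.flatten_append, wtab_eq, constA, tabU, constE, ← List.ofFn_eq_map]
  have e1 : (List.ofFn fun i : Fin U.nstates => ([none, some false, some true].map
        fun a => encodeEntry (Wtrans U x (i.castLE (Nat.le_add_right U.nstates (x.length + 1))) a)).flatten) =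
      List.ofFn fun q => (List.map (fun a => encodeEntry (U.trans q a)) [none, some false, some true]).flatten := by
    congr 1
    funext i
    have hi : i.castLE (Nat.le_add_right U.nstates (x.length + 1)) = Fin.castAdd (x.length + 1) i := rfl
    simp only [hi, Wtrans_left]
    simp only [encodeEntry_map (Fin.castAdd (x.length + 1)) (fun _ => rfl)]
  have e2 : (List.ofFn fun i : Fin x.length => ([none, some false, some true].map
        fun a => encodeEntry (Wtrans U x (Fin.natAdd U.nstates i.castSucc) a)).flatten) =
      List.ofFn fun i : Fin x.length => went (U.nstates + 1 + i.1) (x[i.1]) := by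
    congr 1
    funext i
    have hk : U.nstates + (i.1 + 1) = U.nstates + 1 + i.1 := by omega
    simp only [List.map_cons, List.map_nil, Wtrans_some, Wtrans_none U x i.castSucc i.2, encodeEntry,
      encodeSym, encodeNatU, went, Fin.val_natAdd, Fin.val_castSucc, hk]
    simp
  have e3 : ([none, some false, some true].map
        fun a => encodeEntry (Wtrans U x (Fin.natAdd U.nstates (Fin.last x.length)) a)).flatten =
      true :: (encodeNatU U.q0.val ++ [false, false, false, false, false]) := by
    simp only [List.map_cons, List.map_nil, Wtrans_some, Wtrans_last U x (Fin.last _) (by simp),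
      encodeEntry, encodeSym]
    simp
  rw [e1, e2, e3]
  simp [List.append_assoc]

theorem size_W (U : TM) (x : List Bool) : (W U x).size ≤
      x.length + (constA U).length + (U.nstates + 1 + x.length + 7) * x.length + (constE U).length ∧
    (U.nstates + 8) * x.length + (constA U).length ≤ (W U x).size := by
  have h := wtab_length (U.nstates + 1) x
  rw [TM.size, encode_W]
  simp only [List.length_append, List.length_replicate]
  constructor
  · linarith [h.1]
  · linarith [h.2]

theorem polyTime_g (U : TM) : PolyTimeComputable (fun x => encodeTM (W U x)) := by
  have hT : PB (fun m => (10 * ((U.nstates + 1) + m) + 31) * m +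
      30 * (m + (U.nstates + 1) + (constA U).length + (constE U).length) + 30 +
      2 * ((U.nstates + 1 + m + 7) * m)) := by
    refine PB.add (PB.add (PB.add (PB.mul ?_ PB.id) (PB.mul (PB.const _) ?_)) (PB.const _)) (PB.mul (PB.const _) (PB.mul ?_ PB.id))
    · exact ((PB.const _).mul ((PB.const _).add PB.id)).add (PB.const _)
    · exact ((PB.id.add (PB.const _)).add (PB.const _)).add (PB.const _)
    · exact ((PB.const _).add PB.id).add (PB.const _)
  refine polyTime_of_ex 4 (pgen (constA U) (constE U) (U.nstates + 1)) _ _ hT ?_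
  intro w
  rw [encode_W]
  refine (ex_pgen _ _ _ w).mono ?_
  have := (wtab_length (U.nstates + 1) w).1
  omega


/-! ## The universal simulation program -/

/-- loop rule with a time potential -/
theorem Ex.loopP {i : ℕ} {pf pt} (x0 : List Bool) (G : List Bool → List Bool → List (List Bool))
    (Φ : List Bool → List Bool → ℕ)
    (hG : ∀ c x, (G c x)[i]? = some x) (hΦ : ∀ c, 1 ≤ Φ c [])
    (hb : ∀ c b x, x0 = c.reverse ++ b :: x →
      ∃ t, Ex t (cond b pt pf) ((G c (b :: x)).set i x) (G (b :: c) x) ∧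
        t + 1 + Φ (b :: c) x ≤ Φ c (b :: x)) :
    Ex (Φ [] x0) (Prog.loop i pf pt) (G [] x0) (G x0.reverse []) := by
  suffices h : ∀ x c, x0 = c.reverse ++ x →
      Ex (Φ c x) (Prog.loop i pf pt) (G c x) (G x0.reverse []) from h x0 [] rfl
  intro x
  induction x with
  | nil =>
    intro c hc
    have : x0.reverse = c := by rw [hc]; simp
    rw [this]
    exact (Ex.loop_nil (hG _ _)).mono (hΦ c)
  | cons b x ih =>
    intro c hc
    obtain ⟨t, h1, h2⟩ := hb c b x hc
    exact (Ex.loop_cons (hG _ _) h1 (ih (b :: c) (by rw [hc]; simp))).mono (by omega)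

/-- generalized outcomes -/
def Wp (t : ℕ) (p : Prog) (s : List (List Bool))
    (Q : List Prog → List Prog × List (List Bool) → Prop) : Prop :=
  ∀ K, ∃ c', Rch sstep (fun _ => True) t (p :: K, s) c' ∧ Q K c'

def RejQ (_ : List Prog) (c : List Prog × List (List Bool)) : Prop := ∃ K', c.1 = Prog.rej :: K'

theorem Wp.mono {t u p s Q} (h : Wp t p s Q) (hu : t ≤ u) : Wp u p s Q := fun K => by
  obtain ⟨c, h1, h2⟩ := h K
  exact ⟨c, h1.mono hu, h2⟩

theorem Ex.wp {t p s s'} (h : Ex t p s s') : Wp t p s (fun K c => c = (K, s')) :=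
  fun K => ⟨_, h K, rfl⟩

theorem Wp.ex {t p s s'} (h : Wp t p s (fun K c => c = (K, s'))) : Ex t p s s' := fun K => by
  obtain ⟨c, h1, rfl⟩ := h K
  exact h1

theorem Wp.seq {t u p q s s1 Q} (h : Ex t p s s1) (h' : Wp u q s1 Q) :
    Wp (t + u + 1) (Prog.seq p q) s Q := fun K => by
  obtain ⟨c, h1, h2⟩ := h' K
  exact ⟨c, Rch.step _ _ _ _ trivial rfl ((h _).trans h1), h2⟩

theorem Wp.seq_rej {t p q s} (h : Wp t p s RejQ) : Wp (t + 1) (Prog.seq p q) s RejQ := fun K => by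
  obtain ⟨c, h1, h2⟩ := h (q :: K)
  exact ⟨c, Rch.step _ _ _ _ trivial rfl h1, h2⟩

theorem Wp.rej {s} : Wp 0 Prog.rej s RejQ := fun K => ⟨_, Rch.refl _ _ trivial, K, rfl⟩

theorem Wp.pop_nil {t i p0 pf pt Q} {s : List (List Bool)} (h : s[i]? = some []) (h' : Wp t p0 s Q) :
    Wp (t + 1) (Prog.pop i p0 pf pt) s Q := fun K => by
  obtain ⟨c, h1, h2⟩ := h' K
  exact ⟨c, Rch.step _ _ _ _ trivial (by simp only [sstep, popStep, h]; rfl) h1, h2⟩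

theorem Wp.pop_cons {t i p0 pf pt Q} {b : Bool} {x : List Bool} {s : List (List Bool)}
    (h : s[i]? = some (b :: x)) (h' : Wp t (cond b pt pf) (s.set i x) Q) :
    Wp (t + 1) (Prog.pop i p0 pf pt) s Q := fun K => by
  obtain ⟨c, h1, h2⟩ := h' K
  exact ⟨c, Rch.step _ _ _ _ trivial (by simp only [sstep, popStep, h]; cases b <;> rfl) h1, h2⟩

def moveBit (i j : ℕ) : Prog := Prog.pop i Prog.skip (Prog.push j false) (Prog.push j true)

def moveEntry : Prog :=
  Prog.pop 0 Prog.skip (Prog.push 1 false)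
    (Prog.seq (Prog.push 1 true) (Prog.seq (Prog.unt 0 (Prog.push 1 true))
      (Prog.seq (Prog.push 1 false) (Prog.seq (moveBit 0 1) (Prog.seq (moveBit 0 1) (moveBit 0 1))))))

def moveRow : Prog := Prog.seq moveEntry (Prog.seq moveEntry moveEntry)

theorem encodeSym_form (a : TapeSym) : ∃ s1 s2, encodeSym a = [s1, s2] := by
  cases a with
  | none => exact ⟨_, _, rfl⟩
  | some b => exact ⟨_, _, rfl⟩

theorem ex_moveBit01 (b : Bool) (x y : List Bool) (s : List (List Bool)) :
    Ex 2 (moveBit 0 1) ((b :: x) :: y :: s) (x :: (b :: y) :: s) := by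
  refine Ex.pop_cons (b := b) rfl ?_
  cases b <;> exact Ex.push _ rfl

theorem ex_moveEntry {k : ℕ} (o : Option (Fin k × TapeSym × Bool)) (y z : List Bool)
    (s : List (List Bool)) :
    Ex (2 * (encodeEntry o).length + 20) moveEntry ((encodeEntry o ++ y) :: z :: s)
      (y :: ((encodeEntry o).reverse ++ z) :: s) := by
  cases o with
  | none =>
    refine Ex.mono (t := 2) ?_ (by omega)
    exact Ex.pop_cons rfl (Ex.push _ rfl)
  | some o =>
    obtain ⟨q, a, d⟩ := o
    obtain ⟨s1, s2, hs⟩ := encodeSym_form a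
    have h1 := Ex.unt (i := 0) (p := Prog.push 1 true) (t := 1) q.val (s1 :: s2 :: d :: y)
      (fun j x => x :: (List.replicate j true ++ true :: z) :: s) (fun _ _ => rfl) (fun _ _ _ => rfl)
      (fun j x => Ex.push _ rfl)
    have h2 : Ex 10 (Prog.seq (Prog.push 1 false) (Prog.seq (moveBit 0 1)
        (Prog.seq (moveBit 0 1) (moveBit 0 1))))
        ((s1 :: s2 :: d :: y) :: (List.replicate q.val true ++ true :: z) :: s)
        (y :: (d :: s2 :: s1 :: false :: (List.replicate q.val true ++ true :: z)) :: s) := by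
      exact ((Ex.push _ rfl).seq ((ex_moveBit01 s1 _ _ _).seq
        ((ex_moveBit01 s2 _ _ _).seq (ex_moveBit01 d _ _ _)))).mono (by omega)
    have h3 : Ex 1 (Prog.push 1 true) ((encodeNatU q.val ++ (s1 :: s2 :: d :: y)) :: z :: s)
      ((encodeNatU q.val ++ (s1 :: s2 :: d :: y)) :: (true :: z) :: s) := Ex.push _ rfl
    have h4 := h3.seq (h1.seq h2)
    have e1 : encodeEntry (some (q, a, d)) ++ y = true :: (encodeNatU q.val ++ (s1 :: s2 :: d :: y)) := by
      simp [encodeEntry, hs]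
    rw [e1]
    refine (Ex.pop_cons (b := true) rfl h4).cast ?_ ?_
    · simp [encodeEntry, encodeNatU, hs]; omega
    · simp [encodeEntry, encodeNatU, hs]

/-- table row -/
def row (M : TM) (q : Fin M.nstates) : List Bool :=
  encodeEntry (M.trans q none) ++ (encodeEntry (M.trans q (some false)) ++
    encodeEntry (M.trans q (some true)))

theorem ex_moveRow (M : TM) (q : Fin M.nstates) (y z : List Bool) (s : List (List Bool)) :
    Ex (2 * (row M q).length + 70) moveRow ((row M q ++ y) :: z :: s)
      (y :: ((row M q).reverse ++ z) :: s) := by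
  have h1 := ex_moveEntry (M.trans q none) (encodeEntry (M.trans q (some false)) ++
    (encodeEntry (M.trans q (some true)) ++ y)) z s
  have h2 := ex_moveEntry (M.trans q (some false)) (encodeEntry (M.trans q (some true)) ++ y)
    ((encodeEntry (M.trans q none)).reverse ++ z) s
  have h3 := ex_moveEntry (M.trans q (some true)) y ((encodeEntry (M.trans q (some false))).reverse ++
    ((encodeEntry (M.trans q none)).reverse ++ z)) s
  have e1 : row M q ++ y = encodeEntry (M.trans q none) ++ (encodeEntry (M.trans q (some false)) ++
    (encodeEntry (M.trans q (some true)) ++ y)) := by simp [row]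
  rw [e1]
  refine (h1.seq (h2.seq h3)).cast ?_ ?_
  · simp [row]; omega
  · simp [row]

def rows (M : TM) : List (List Bool) := List.ofFn (row M)

theorem rows_length (M : TM) : (rows M).length = M.nstates := by simp [rows]

theorem rows_drop (M : TM) (q : Fin M.nstates) :
    ((rows M).drop q.val).flatten = row M q ++ ((rows M).drop (q.val + 1)).flatten := by
  rw [List.drop_eq_getElem_cons (by simp [rows])]
  simp [rows]

theorem rows_take (M : TM) (q : Fin M.nstates) :
    ((rows M).take (q.val + 1)).flatten = ((rows M).take q.val).flatten ++ row M q := by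
  rw [List.take_add_one]
  simp [rows]

theorem encodeTM_rows (M : TM) : encodeTM M = encodeNatU M.nstates ++ (encodeNatU M.q0.val ++
    (encodeNatU M.qacc.val ++ (rows M).flatten)) := by
  simp only [encodeTM, rows, ← List.ofFn_eq_map, List.append_assoc]
  congr 5
  funext q
  simp [row]

/-! ### One simulated step -/

def cmpP : Prog :=
  Prog.seq (Prog.loop 3 Prog.skip (Prog.pop 9 Prog.rej Prog.skip Prog.skip))
    (Prog.pop 9 Prog.skip Prog.rej Prog.rej)

def useFree : Prog := Prog.pop 8 Prog.rej Prog.skip Prog.skip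

def dirR : Prog :=
  Prog.seq (Prog.push 1 true) (Prog.seq (moveBit 5 4) (Prog.seq (moveBit 5 4)
    (Prog.seq (Prog.push 6 true) (Prog.pop 7 useFree Prog.skip Prog.skip))))

def dirL : Prog :=
  Prog.seq (Prog.push 1 false)
    (Prog.seq (Prog.pop 4 (Prog.seq (Prog.push 5 false) (Prog.push 5 false))
        (Prog.seq (Prog.push 5 false) (moveBit 4 5)) (Prog.seq (Prog.push 5 true) (moveBit 4 5)))
    (Prog.seq (Prog.push 7 true) (Prog.pop 6 useFree Prog.skip Prog.skip)))

def symP : Prog :=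
  Prog.pop 0 Prog.skip
    (Prog.seq (Prog.push 1 false) (Prog.seq (moveBit 0 1)
      (Prog.seq (Prog.push 5 false) (Prog.push 5 false))))
    (Prog.seq (Prog.push 1 true) (Prog.pop 0 Prog.skip
      (Prog.seq (Prog.push 1 false) (Prog.seq (Prog.push 5 false) (Prog.push 5 true)))
      (Prog.seq (Prog.push 1 true) (Prog.seq (Prog.push 5 true) (Prog.push 5 true)))))

def restP : Prog := Prog.seq (mv 1 0) (Prog.push 10 true)

def contP : Prog :=
  Prog.seq (Prog.push 1 true)
  (Prog.seq (Prog.loop 3 Prog.skip Prog.skip)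
  (Prog.seq (Prog.unt 0 (Prog.seq (Prog.push 1 true) (Prog.push 2 true)))
  (Prog.seq (Prog.push 1 false)
  (Prog.seq symP
  (Prog.seq (Prog.pop 0 Prog.skip dirL dirR) restP)))))

def actP : Prog := Prog.pop 0 Prog.skip cmpP contP

def readP : Prog :=
  Prog.pop 5 actP (Prog.seq (Prog.pop 5 Prog.skip Prog.skip Prog.skip) actP)
    (Prog.pop 5 Prog.skip (Prog.seq moveEntry actP) (Prog.seq moveEntry (Prog.seq moveEntry actP)))

def bodyP : Prog :=
  Prog.seq (Prog.loop 2 Prog.skip (Prog.seq moveRow (Prog.push 3 true))) readP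

def cR (R : List TapeSym) : List Bool := R.flatMap encodeSym
def cL (L : List TapeSym) : List Bool := L.flatMap fun a => (encodeSym a).reverse

/-- unary -/
abbrev un (n : ℕ) : List Bool := List.replicate n true

theorem Wp.loop_cons {t u i : ℕ} {pf pt Q} {b : Bool} {x : List Bool} {s s' : List (List Bool)}
    (h : s[i]? = some (b :: x))
    (h' : Ex t (cond b pt pf) (s.set i x) s') (h'' : Wp u (Prog.loop i pf pt) s' Q) :
    Wp (t + u + 1) (Prog.loop i pf pt) s Q := fun K => by
  obtain ⟨c, h1, h2⟩ := h'' K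
  exact ⟨c, Rch.step _ _ (cond b pt pf :: Prog.loop i pf pt :: K, s.set i x) _ trivial
    (by simp only [sstep, popStep, h]; cases b <;> rfl) ((h' _).trans h1), h2⟩

theorem Wp.loop_rej {t i : ℕ} {pf pt} {b : Bool} {x : List Bool} {s : List (List Bool)}
    (h : s[i]? = some (b :: x)) (h' : Wp t (cond b pt pf) (s.set i x) RejQ) :
    Wp (t + 1) (Prog.loop i pf pt) s RejQ := fun K => by
  obtain ⟨c, h1, h2⟩ := h' (Prog.loop i pf pt :: K)
  exact ⟨c, Rch.step _ _ (cond b pt pf :: Prog.loop i pf pt :: K, s.set i x) _ trivial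
    (by simp only [sstep, popStep, h]; cases b <;> rfl) h1, h2⟩

theorem ex_cmpLoop (q a : ℕ) (r0 r1 r2 r4 r5 r6 r7 r8 r10 : List Bool) :
    Ex (3 * q + 1) (Prog.loop 3 Prog.skip (Prog.pop 9 Prog.rej Prog.skip Prog.skip))
      [r0, r1, r2, un q, r4, r5, r6, r7, r8, un (q + a), r10]
      [r0, r1, r2, [], r4, r5, r6, r7, r8, un a, r10] := by
  induction q with
  | zero => simpa using Ex.loop_nil rfl
  | succ q ih =>
    have e : un (q + 1 + a) = true :: un (q + a) := by
      rw [show q + 1 + a = q + a + 1 by omega]; rfl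
    rw [e]
    refine (Ex.loop_cons (t := 2) (b := true) rfl ?_ ih).mono (by omega)
    exact Ex.pop_cons (b := true) rfl (Ex.skip _)

theorem wp_cmpLoop (q a : ℕ) (r0 r1 r2 r4 r5 r6 r7 r8 r10 : List Bool) :
    Wp (3 * a + 2) (Prog.loop 3 Prog.skip (Prog.pop 9 Prog.rej Prog.skip Prog.skip))
      [r0, r1, r2, un (a + q + 1), r4, r5, r6, r7, r8, un a, r10] RejQ := by
  induction a with
  | zero => exact Wp.loop_rej (b := true) (x := un (0 + q)) rfl (Wp.pop_nil rfl Wp.rej)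
  | succ a ih =>
    have e : un (a + 1 + q + 1) = true :: un (a + q + 1) := by
      rw [show a + 1 + q + 1 = (a + q + 1) + 1 by omega]; rfl
    rw [e]
    refine (Wp.loop_cons (t := 2) (b := true) rfl ?_ ih).mono (by omega)
    exact Ex.pop_cons (b := true) rfl (Ex.skip _)

theorem ex_cmp_eq (q : ℕ) (r0 r1 r2 r4 r5 r6 r7 r8 r10 : List Bool) :
    Ex (3 * q + 10) cmpP [r0, r1, r2, un q, r4, r5, r6, r7, r8, un q, r10]
      [r0, r1, r2, [], r4, r5, r6, r7, r8, [], r10] :=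
  ((ex_cmpLoop q 0 r0 r1 r2 r4 r5 r6 r7 r8 r10).seq (Ex.pop_nil rfl (Ex.skip _))).mono (by omega)

theorem wp_cmp_ne (q a : ℕ) (h : q ≠ a) (r0 r1 r2 r4 r5 r6 r7 r8 r10 : List Bool) :
    Wp (3 * a + 10) cmpP [r0, r1, r2, un q, r4, r5, r6, r7, r8, un a, r10] RejQ := by
  rcases Nat.lt_or_gt_of_ne h with h | h
  · obtain ⟨d, rfl⟩ : ∃ d, a = q + (d + 1) := ⟨a - q - 1, by omega⟩
    exact (Wp.seq (ex_cmpLoop q (d + 1) r0 r1 r2 r4 r5 r6 r7 r8 r10)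
      (Wp.pop_cons (b := true) rfl Wp.rej)).mono (by omega)
  · obtain ⟨d, rfl⟩ : ∃ d, q = a + d + 1 := ⟨q - a - 1, by omega⟩
    exact (wp_cmpLoop d a r0 r1 r2 r4 r5 r6 r7 r8 r10).seq_rej.mono (by omega)

/-- the new values of (a, b, free) after moving in direction with counters -/
theorem ex_useFree (fr : ℕ) (r0 r1 r2 r3 r4 r5 r6 r7 r9 r10 : List Bool) :
    Ex 2 useFree [r0, r1, r2, r3, r4, r5, r6, r7, un (fr + 1), r9, r10]
      [r0, r1, r2, r3, r4, r5, r6, r7, un fr, r9, r10] :=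
  Ex.pop_cons (b := true) rfl (Ex.skip _)

theorem wp_useFree (r0 r1 r2 r3 r4 r5 r6 r7 r9 r10 : List Bool) :
    Wp 1 useFree [r0, r1, r2, r3, r4, r5, r6, r7, un 0, r9, r10] RejQ :=
  Wp.pop_nil rfl Wp.rej

theorem ex_sym (z : TapeSym) (x r1 r2 r3 r4 r5 r6 r7 r8 r9 r10 : List Bool) :
    Ex 20 symP [encodeSym z ++ x, r1, r2, r3, r4, r5, r6, r7, r8, r9, r10]
      [x, (encodeSym z).reverse ++ r1, r2, r3, r4, encodeSym z ++ r5, r6, r7, r8, r9, r10] := by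
  rcases z with _ | _ | _ <;>
  · intro K
    repeat (first | exact Rch.refl _ _ trivial | refine Rch.step _ _ _ _ trivial rfl ?_)

/-- moving the tape right: common prefix -/
theorem ex_right1 (z : TapeSym) (r0 r1 r2 r3 r4 r5 r6 r7 r8 r9 r10 : List Bool)
    {t Q} (h : Wp t (Prog.pop 7 useFree Prog.skip Prog.skip)
      [r0, true :: r1, r2, r3, (encodeSym z).reverse ++ r4, r5, true :: r6, r7, r8, r9, r10] Q) :
    Wp (t + 20) dirR [r0, r1, r2, r3, r4, encodeSym z ++ r5, r6, r7, r8, r9, r10] Q := by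
  obtain ⟨s1, s2, hs⟩ := encodeSym_form z
  rw [hs] at h ⊢
  have hm : ∀ (b : Bool) (r1 r4 r5 : List Bool), Ex 2 (moveBit 5 4)
      [r0, r1, r2, r3, r4, b :: r5, r6, r7, r8, r9, r10] [r0, r1, r2, r3, b :: r4, r5, r6, r7, r8, r9, r10] := by
    intro b r1 r4 r5
    refine Ex.pop_cons (b := b) rfl ?_
    cases b <;> exact Ex.push _ rfl
  exact (Wp.seq (Ex.push _ rfl) (Wp.seq (hm s1 _ _ _) (Wp.seq (hm s2 _ _ _)
    (Wp.seq (Ex.push _ rfl) h)))).mono (by omega)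

theorem ex_left1 (L : List TapeSym) (r0 r1 r2 r3 r5 r6 r7 r8 r9 r10 : List Bool)
    {t Q} (h : Wp t (Prog.pop 6 useFree Prog.skip Prog.skip)
      [r0, false :: r1, r2, r3, cL L.tail, encodeSym (L.headD none) ++ r5, r6, true :: r7, r8, r9, r10] Q) :
    Wp (t + 20) dirL [r0, r1, r2, r3, cL L, r5, r6, r7, r8, r9, r10] Q := by
  have h1 : Ex 10 (Prog.pop 4 (Prog.seq (Prog.push 5 false) (Prog.push 5 false))
        (Prog.seq (Prog.push 5 false) (moveBit 4 5)) (Prog.seq (Prog.push 5 true) (moveBit 4 5)))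
      [r0, false :: r1, r2, r3, cL L, r5, r6, r7, r8, r9, r10]
      [r0, false :: r1, r2, r3, cL L.tail, encodeSym (L.headD none) ++ r5, r6, r7, r8, r9, r10] := by
    rcases L with _ | ⟨_ | _ | _, L⟩ <;>
    · intro K
      repeat (first | exact Rch.refl _ _ trivial | refine Rch.step _ _ _ _ trivial rfl ?_)
  exact (Wp.seq (Ex.push _ rfl) (Wp.seq h1 (Wp.seq (Ex.push _ rfl) h))).mono (by omega)

theorem ex_rest (y z r2 r3 r4 r5 r6 r7 r8 r9 r10 : List Bool) :
    Ex (2 * z.length + 4) restP [y, z.reverse, r2, r3, r4, r5, r6, r7, r8, r9, r10]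
      [z ++ y, [], r2, r3, r4, r5, r6, r7, r8, r9, true :: r10] := by
  have h8 := Ex.loop (i := 1) (t := 1) (pf := Prog.push 0 false) (pt := Prog.push 0 true)
      z.reverse (fun c x => [c ++ y, x, r2, r3, r4, r5, r6, r7, r8, r9, r10]) (fun _ _ => rfl) (by
        intro c b y h
        cases b <;> exact Ex.push _ rfl)
  refine (h8.seq (Ex.push _ rfl)).cast ?_ ?_
  · simp
  · simp

theorem wp_pre {k : ℕ} (q' : Fin k) (z : TapeSym) (d : Bool) (q : ℕ)
    (pre suf r4 r5 r6 r7 r8 r9 r10 : List Bool) {t Q}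
    (h : Wp t (Prog.seq (Prog.pop 0 Prog.skip dirL dirR) restP)
      [d :: suf, (pre ++ (true :: (encodeNatU q'.val ++ encodeSym z))).reverse, un q'.val, [], r4,
        encodeSym z ++ r5, r6, r7, r8, r9, r10] Q) :
    Wp (t + 4 * q'.val + 2 * q + 40) actP
      [encodeEntry (some (q', z, d)) ++ suf, pre.reverse, [], un q, r4, r5, r6, r7, r8, r9, r10] Q := by
  have e1 : encodeEntry (some (q', z, d)) ++ suf =
      true :: (encodeNatU q'.val ++ (encodeSym z ++ d :: suf)) := by
    simp [encodeEntry]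
  rw [e1]
  have h1 : Ex 1 (Prog.push 1 true)
      [encodeNatU q'.val ++ (encodeSym z ++ d :: suf), pre.reverse, [], un q, r4, r5, r6, r7, r8, r9, r10]
      [encodeNatU q'.val ++ (encodeSym z ++ d :: suf), true :: pre.reverse, [], un q, r4, r5, r6, r7, r8, r9, r10] :=
    Ex.push _ rfl
  have h2 := Ex.loop (i := 3) (t := 1) (pf := Prog.skip) (pt := Prog.skip) (un q)
    (fun c x => [encodeNatU q'.val ++ (encodeSym z ++ d :: suf), true :: pre.reverse, [], x, r4, r5, r6, r7, r8, r9, r10])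
    (fun _ _ => rfl) (by intro c b y h; cases b <;> exact Ex.skip _)
  have h3 := Ex.unt (i := 0) (t := 3) (p := Prog.seq (Prog.push 1 true) (Prog.push 2 true)) q'.val
    (encodeSym z ++ d :: suf)
    (fun j x => [x, un j ++ true :: pre.reverse, un j, [], r4, r5, r6, r7, r8, r9, r10])
    (fun _ _ => rfl) (fun _ _ _ => rfl)
    (fun j x => (Ex.push (b := true) (i := 1) (un j ++ true :: pre.reverse) rfl).seq (Ex.push (i := 2) _ rfl))
  have h4 : Ex 1 (Prog.push 1 false)
      [encodeSym z ++ d :: suf, un q'.val ++ true :: pre.reverse, un q'.val, [], r4, r5, r6, r7, r8, r9, r10]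
      [encodeSym z ++ d :: suf, false :: (un q'.val ++ true :: pre.reverse), un q'.val, [], r4, r5, r6, r7, r8, r9, r10] :=
    Ex.push _ rfl
  have h5 := ex_sym z (d :: suf) (false :: (un q'.val ++ true :: pre.reverse)) (un q'.val) [] r4 r5 r6 r7 r8 r9 r10
  have e2 : (pre ++ (true :: (encodeNatU q'.val ++ encodeSym z))).reverse =
      (encodeSym z).reverse ++ false :: (un q'.val ++ true :: pre.reverse) := by
    simp [encodeNatU]
  rw [e2] at h
  have h6 := Wp.seq h1 (Wp.seq h2 (Wp.seq h3 (Wp.seq h4 (Wp.seq h5 h))))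
  refine (Wp.pop_cons (b := true) rfl h6).mono ?_
  simp
  omega

/-- updating the space counters: `b` is the room in the direction of the move -/
def Cnt (b fr b' fr' : ℕ) : Prop := (b = b' + 1 ∧ fr = fr') ∨ (b = 0 ∧ b' = 0 ∧ fr = fr' + 1)

theorem ex_right {k : ℕ} (q' : Fin k) (z : TapeSym) (q a b fr b' fr' : ℕ) (hc : Cnt b fr b' fr')
    (pre suf r4 r5 r9 : List Bool) :
    Ex (4 * q'.val + 2 * q + 2 * (pre ++ encodeEntry (some (q', z, true))).length + 100) actP
      [encodeEntry (some (q', z, true)) ++ suf, pre.reverse, [], un q, r4, r5, un a, un b, un fr, r9, []]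
      [pre ++ encodeEntry (some (q', z, true)) ++ suf, [], un q'.val, [], (encodeSym z).reverse ++ r4, r5,
        un (a + 1), un b', un fr', r9, [true]] := by
  set P := (pre ++ (true :: (encodeNatU q'.val ++ encodeSym z))).reverse with hP
  have h1 : Ex 4 (Prog.pop 7 useFree Prog.skip Prog.skip)
      [suf, true :: P, un q'.val, [], (encodeSym z).reverse ++ r4, r5, true :: un a, un b, un fr, r9, []]
      [suf, true :: P, un q'.val, [], (encodeSym z).reverse ++ r4, r5, un (a + 1), un b', un fr', r9, []] := by
    rcases hc with ⟨rfl, rfl⟩ | ⟨rfl, rfl, rfl⟩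
    · exact (Ex.pop_cons (b := true) rfl (Ex.skip _)).mono (by omega)
    · exact (Ex.pop_nil rfl (ex_useFree _ _ _ _ _ _ _ _ _ _ _)).mono (by omega)
  have h2 := (ex_right1 z suf P (un q'.val) [] r4 r5 (un a) (un b) (un fr) r9 [] h1.wp).ex
  have e : true :: P = (pre ++ encodeEntry (some (q', z, true))).reverse := by
    simp [hP, encodeEntry]
  rw [e] at h2
  have h3 := ex_rest suf (pre ++ encodeEntry (some (q', z, true))) (un q'.val) []
    ((encodeSym z).reverse ++ r4) r5 (un (a + 1)) (un b') (un fr') r9 []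
  have h4 := (Ex.pop_cons (i := 0) (b := true) (p0 := Prog.skip) (pf := dirL) (pt := dirR)
    (s := [true :: suf, P, un q'.val, [], r4, encodeSym z ++ r5, un a, un b, un fr, r9, []]) rfl h2).seq h3
  exact (wp_pre q' z true q pre suf r4 r5 (un a) (un b) (un fr) r9 [] h4.wp).ex.mono (by omega)

theorem wp_right {k : ℕ} (q' : Fin k) (z : TapeSym) (q a : ℕ)
    (pre suf r4 r5 r9 : List Bool) :
    Wp (4 * q'.val + 2 * q + 100) actP
      [encodeEntry (some (q', z, true)) ++ suf, pre.reverse, [], un q, r4, r5, un a, un 0, un 0, r9, []]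
      RejQ := by
  set P := (pre ++ (true :: (encodeNatU q'.val ++ encodeSym z))).reverse with hP
  have h1 : Wp 4 (Prog.pop 7 useFree Prog.skip Prog.skip)
      [suf, true :: P, un q'.val, [], (encodeSym z).reverse ++ r4, r5, true :: un a, un 0, un 0, r9, []] RejQ :=
    (Wp.pop_nil rfl (wp_useFree _ _ _ _ _ _ _ _ _ _)).mono (by omega)
  have h2 := ex_right1 z suf P (un q'.val) [] r4 r5 (un a) (un 0) (un 0) r9 [] h1
  have h4 := (Wp.pop_cons (i := 0) (b := true) (p0 := Prog.skip) (pf := dirL) (pt := dirR)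
    (s := [true :: suf, P, un q'.val, [], r4, encodeSym z ++ r5, un a, un 0, un 0, r9, []]) rfl h2).seq_rej (q := restP)
  exact (wp_pre q' z true q pre suf r4 r5 (un a) (un 0) (un 0) r9 [] h4).mono (by omega)

theorem ex_left {k : ℕ} (q' : Fin k) (z : TapeSym) (q a b fr a' fr' : ℕ) (hc : Cnt a fr a' fr')
    (L : List TapeSym) (pre suf r5 r9 : List Bool) :
    Ex (4 * q'.val + 2 * q + 2 * (pre ++ encodeEntry (some (q', z, false))).length + 100) actP
      [encodeEntry (some (q', z, false)) ++ suf, pre.reverse, [], un q, cL L, r5, un a, un b, un fr, r9, []]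
      [pre ++ encodeEntry (some (q', z, false)) ++ suf, [], un q'.val, [], cL L.tail,
        encodeSym (L.headD none) ++ (encodeSym z ++ r5), un a', un (b + 1), un fr', r9, [true]] := by
  set P := (pre ++ (true :: (encodeNatU q'.val ++ encodeSym z))).reverse with hP
  have h1 : Ex 4 (Prog.pop 6 useFree Prog.skip Prog.skip)
      [suf, false :: P, un q'.val, [], cL L.tail, encodeSym (L.headD none) ++ (encodeSym z ++ r5),
        un a, true :: un b, un fr, r9, []]
      [suf, false :: P, un q'.val, [], cL L.tail, encodeSym (L.headD none) ++ (encodeSym z ++ r5),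
        un a', un (b + 1), un fr', r9, []] := by
    rcases hc with ⟨rfl, rfl⟩ | ⟨rfl, rfl, rfl⟩
    · exact (Ex.pop_cons (b := true) rfl (Ex.skip _)).mono (by omega)
    · exact (Ex.pop_nil rfl (ex_useFree _ _ _ _ _ _ _ _ _ _ _)).mono (by omega)
  have h2 := (ex_left1 L suf P (un q'.val) [] (encodeSym z ++ r5) (un a) (un b) (un fr) r9 [] h1.wp).ex
  have e : false :: P = (pre ++ encodeEntry (some (q', z, false))).reverse := by
    simp [hP, encodeEntry]
  rw [e] at h2
  have h3 := ex_rest suf (pre ++ encodeEntry (some (q', z, false))) (un q'.val) []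
    (cL L.tail) (encodeSym (L.headD none) ++ (encodeSym z ++ r5)) (un a') (un (b + 1)) (un fr') r9 []
  have h4 := (Ex.pop_cons (i := 0) (b := false) (p0 := Prog.skip) (pf := dirL) (pt := dirR)
    (s := [false :: suf, P, un q'.val, [], cL L, encodeSym z ++ r5, un a, un b, un fr, r9, []]) rfl h2).seq h3
  exact (wp_pre q' z false q pre suf (cL L) r5 (un a) (un b) (un fr) r9 [] h4.wp).ex.mono (by omega)

theorem wp_left {k : ℕ} (q' : Fin k) (z : TapeSym) (q b : ℕ)
    (L : List TapeSym) (pre suf r5 r9 : List Bool) :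
    Wp (4 * q'.val + 2 * q + 100) actP
      [encodeEntry (some (q', z, false)) ++ suf, pre.reverse, [], un q, cL L, r5, un 0, un b, un 0, r9, []]
      RejQ := by
  set P := (pre ++ (true :: (encodeNatU q'.val ++ encodeSym z))).reverse with hP
  have h1 : Wp 4 (Prog.pop 6 useFree Prog.skip Prog.skip)
      [suf, false :: P, un q'.val, [], cL L.tail, encodeSym (L.headD none) ++ (encodeSym z ++ r5),
        un 0, true :: un b, un 0, r9, []] RejQ :=
    (Wp.pop_nil rfl (wp_useFree _ _ _ _ _ _ _ _ _ _)).mono (by omega)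
  have h2 := ex_left1 L suf P (un q'.val) [] (encodeSym z ++ r5) (un 0) (un b) (un 0) r9 [] h1
  have h4 := (Wp.pop_cons (i := 0) (b := false) (p0 := Prog.skip) (pf := dirL) (pt := dirR)
    (s := [false :: suf, P, un q'.val, [], cL L, encodeSym z ++ r5, un 0, un b, un 0, r9, []]) rfl h2).seq_rej (q := restP)
  exact (wp_pre q' z false q pre suf (cL L) r5 (un 0) (un b) (un 0) r9 [] h4).mono (by omega)

theorem wp_body (M : TM) (q : Fin M.nstates) (R : List TapeSym) (r4 r6 r7 r8 r9 r10 : List Bool) {t Q}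
    (h : ∀ pre suf, pre ++ encodeEntry (M.trans q (R.headD none)) ++ suf = (rows M).flatten →
      Wp t actP [encodeEntry (M.trans q (R.headD none)) ++ suf, pre.reverse, [], un q.val, r4, cR R.tail,
        r6, r7, r8, r9, r10] Q) :
    Wp (t + (4 * (rows M).flatten.length + 80 * q.val + 100)) bodyP
      [(rows M).flatten, [], un q.val, [], r4, cR R, r6, r7, r8, r9, r10] Q := by
  have h1 := Ex.loopP (i := 2) (pf := Prog.skip) (pt := Prog.seq moveRow (Prog.push 3 true)) (un q.val)
    (fun c y => [((rows M).drop c.length).flatten, ((rows M).take c.length).flatten.reverse, y, c, r4, cR R,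
      r6, r7, r8, r9, r10])
    (fun c y => 2 * ((rows M).drop c.length).flatten.length + 75 * y.length + 1)
    (fun _ _ => rfl) (by simp) (by
      intro c b x hx
      have hb : b = true := by
        have : b ∈ un q.val := by rw [hx]; simp
        exact List.eq_of_mem_replicate this
      subst hb
      have hl : c.length < q.val := by
        have := congrArg List.length hx
        simp at this; omega
      have hr := ex_moveRow M ⟨c.length, by omega⟩ ((rows M).drop (c.length + 1)).flatten
        ((rows M).take c.length).flatten.reverse [x, c, r4, cR R, r6, r7, r8, r9, r10]
      have hd := rows_drop M ⟨c.length, by omega⟩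
      have ht := rows_take M ⟨c.length, by omega⟩
      simp only at hd ht
      rw [← hd, ← List.reverse_append, ← ht] at hr
      refine ⟨_, hr.seq (Ex.push _ rfl), ?_⟩
      simp only [List.length_cons]
      have := congrArg List.length hd
      rw [List.length_append] at this
      omega)
  have e1 : ∀ f : List (List Bool) → List Bool, (un q.val).reverse = un q.val := by simp
  simp only [e1 (fun _ => []), List.length_nil, List.length_replicate, List.drop_zero, List.take_zero,
    List.flatten_nil, List.reverse_nil] at h1
  refine (Wp.seq h1 (u := t + (2 * (rows M).flatten.length + 60)) ?_).mono (by omega)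
  rw [rows_drop]
  have hT : ((rows M).take q.val).flatten ++ (row M q ++ ((rows M).drop (q.val + 1)).flatten) = (rows M).flatten := by
    rw [← rows_drop, ← List.flatten_append, List.take_append_drop]
  have hlen := congrArg List.length hT
  simp only [row, List.length_append] at hlen
  set pre := ((rows M).take q.val).flatten
  set suf := ((rows M).drop (q.val + 1)).flatten
  rw [row] at hT ⊢
  simp only [List.append_assoc] at hT ⊢
  rcases R with _ | ⟨_ | _ | _, R⟩
  · refine (Wp.pop_nil rfl (h pre _ ?_)).mono (by omega)
    simp only [List.append_assoc]; exact hT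
  · refine (Wp.pop_cons (b := false) rfl (Wp.seq (Ex.pop_cons (b := false) rfl (Ex.skip _)) (h pre _ ?_))).mono (by omega)
    simp only [List.append_assoc]; exact hT
  · have h2 := ex_moveEntry (M.trans q none) (encodeEntry (M.trans q (some false)) ++ (encodeEntry (M.trans q (some true)) ++ suf))
      pre.reverse [[], un q.val, r4, cR R, r6, r7, r8, r9, r10]
    rw [← List.reverse_append] at h2
    refine (Wp.pop_cons (b := true) rfl (Wp.pop_cons (b := false) rfl (Wp.seq h2 (h _ _ ?_)))).mono (by omega)
    simp only [List.append_assoc]; exact hT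
  · have h2 := ex_moveEntry (M.trans q none) (encodeEntry (M.trans q (some false)) ++ (encodeEntry (M.trans q (some true)) ++ suf))
      pre.reverse [[], un q.val, r4, cR R, r6, r7, r8, r9, r10]
    rw [← List.reverse_append] at h2
    have h3 := ex_moveEntry (M.trans q (some false)) (encodeEntry (M.trans q (some true)) ++ suf)
      (pre ++ encodeEntry (M.trans q none)).reverse [[], un q.val, r4, cR R, r6, r7, r8, r9, r10]
    rw [← List.reverse_append] at h3
    refine (Wp.pop_cons (b := true) rfl (Wp.pop_cons (b := true) rfl (Wp.seq h2 (Wp.seq h3 (h _ _ ?_))))).mono (by omega)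
    simp only [List.append_assoc]; exact hT

/-- simulation state -/
def SS (M : TM) (q : Fin M.nstates) (L R : List TapeSym) (a b fr : ℕ) (fl : List Bool) : List (List Bool) :=
  [(rows M).flatten, [], un q.val, [], cL L, cR R, un a, un b, un fr, un M.qacc.val, fl]

/-- time bound for one simulated step -/
def TB (M : TM) : ℕ := 10 * (rows M).flatten.length + 100 * M.nstates + 300

/-- normal exit with empty flag -/
def AccQ (K : List Prog) (c : List Prog × List (List Bool)) : Prop := c.1 = K ∧ c.2[10]? = some []

theorem body_acc (M : TM) (q : Fin M.nstates) (L R : List TapeSym) (a b fr : ℕ)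
    (h : M.trans q (R.headD none) = none) (hq : q = M.qacc) :
    Wp (TB M) bodyP (SS M q L R a b fr []) AccQ := by
  have hqk := q.2
  refine (wp_body M q R (cL L) (un a) (un b) (un fr) (un M.qacc.val) [] (t := 3 * q.val + 20) ?_).mono
    (by unfold TB; omega)
  intro pre suf _
  rw [h]
  have h1 := ex_cmp_eq q.val suf pre.reverse [] (cL L) (cR R.tail) (un a) (un b) (un fr) []
  have h2 := Ex.pop_cons (i := 0) (b := false) (p0 := Prog.skip) (pf := cmpP) (pt := contP)
    (s := [false :: suf, pre.reverse, [], un q.val, cL L, cR R.tail, un a, un b, un fr, un q.val, []]) rfl h1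
  rw [← hq]
  intro K
  exact ⟨_, (h2 K).mono (by omega), rfl, rfl⟩

theorem body_rej (M : TM) (q : Fin M.nstates) (L R : List TapeSym) (a b fr : ℕ)
    (h : M.trans q (R.headD none) = none) (hq : q ≠ M.qacc) :
    Wp (TB M) bodyP (SS M q L R a b fr []) RejQ := by
  have hqk := q.2
  have hqa := M.qacc.2
  refine (wp_body M q R (cL L) (un a) (un b) (un fr) (un M.qacc.val) [] (t := 3 * M.qacc.val + 20) ?_).mono
    (by unfold TB; omega)
  intro pre suf _
  rw [h]
  have h1 := wp_cmp_ne q.val M.qacc.val (fun h => hq (Fin.ext h)) suf pre.reverse [] (cL L) (cR R.tail)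
    (un a) (un b) (un fr) []
  exact (Wp.pop_cons (i := 0) (b := false) (p0 := Prog.skip) (pf := cmpP) (pt := contP)
    (s := [false :: suf, pre.reverse, [], un q.val, cL L, cR R.tail, un a, un b, un fr, un M.qacc.val, []])
    rfl h1).mono (by omega)

theorem body_right (M : TM) (q q' : Fin M.nstates) (z : TapeSym) (L R : List TapeSym) (a b fr b' fr' : ℕ)
    (h : M.trans q (R.headD none) = some (q', z, true)) (hc : Cnt b fr b' fr') :
    Ex (TB M) bodyP (SS M q L R a b fr []) (SS M q' (z :: L) R.tail (a + 1) b' fr' [true]) := by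
  have hqk := q.2
  have hqa := q'.2
  refine ((wp_body M q R (cL L) (un a) (un b) (un fr) (un M.qacc.val) []
    (t := 4 * q'.val + 2 * q.val + 2 * (rows M).flatten.length + 100) ?_).mono
    (by unfold TB; omega)).ex
  intro pre suf hT
  rw [h] at hT ⊢
  have h1 := ex_right q' z q.val a b fr b' fr' hc pre suf (cL L) (cR R.tail) (un M.qacc.val)
  have hl := congrArg List.length hT
  rw [List.length_append] at hl
  rw [hT] at h1
  exact (h1.mono (by omega)).wp

theorem body_right_rej (M : TM) (q q' : Fin M.nstates) (z : TapeSym) (L R : List TapeSym) (a : ℕ)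
    (h : M.trans q (R.headD none) = some (q', z, true)) :
    Wp (TB M) bodyP (SS M q L R a 0 0 []) RejQ := by
  have hqk := q.2
  have hqa := q'.2
  refine (wp_body M q R (cL L) (un a) (un 0) (un 0) (un M.qacc.val) []
    (t := 4 * q'.val + 2 * q.val + 100) ?_).mono (by unfold TB; omega)
  intro pre suf hT
  rw [h]
  exact wp_right q' z q.val a pre suf (cL L) (cR R.tail) (un M.qacc.val)

theorem body_left (M : TM) (q q' : Fin M.nstates) (z : TapeSym) (L R : List TapeSym) (a b fr a' fr' : ℕ)
    (h : M.trans q (R.headD none) = some (q', z, false)) (hc : Cnt a fr a' fr') :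
    Ex (TB M) bodyP (SS M q L R a b fr [])
      (SS M q' L.tail (L.headD none :: z :: R.tail) a' (b + 1) fr' [true]) := by
  have hqk := q.2
  have hqa := q'.2
  refine ((wp_body M q R (cL L) (un a) (un b) (un fr) (un M.qacc.val) []
    (t := 4 * q'.val + 2 * q.val + 2 * (rows M).flatten.length + 100) ?_).mono
    (by unfold TB; omega)).ex
  intro pre suf hT
  rw [h] at hT ⊢
  have h1 := ex_left q' z q.val a b fr a' fr' hc L pre suf (cR R.tail) (un M.qacc.val)
  have hl := congrArg List.length hT
  rw [List.length_append] at hl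
  rw [hT] at h1
  exact (h1.mono (by omega)).wp

theorem body_left_rej (M : TM) (q q' : Fin M.nstates) (z : TapeSym) (L R : List TapeSym) (b : ℕ)
    (h : M.trans q (R.headD none) = some (q', z, false)) :
    Wp (TB M) bodyP (SS M q L R 0 b 0 []) RejQ := by
  have hqk := q.2
  have hqa := q'.2
  refine (wp_body M q R (cL L) (un 0) (un b) (un 0) (un M.qacc.val) []
    (t := 4 * q'.val + 2 * q.val + 100) ?_).mono (by unfold TB; omega)
  intro pre suf hT
  rw [h]
  exact wp_left q' z q.val b L pre suf (cR R.tail) (un M.qacc.val)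

/-! ### The simulation invariant -/

structure SimInv (M : TM) (w : List Bool) (n k : ℕ) (c : TMCfg M) (L R : List TapeSym) (a b fr : ℕ) :
    Prop where
  run : M.run w k = some c
  right : ∀ i : ℕ, c.tape (c.pos + i) = R.getD i none
  left : ∀ i : ℕ, c.tape (c.pos - 1 - i) = L.getD i none
  rng : ∀ j c', j ≤ k → M.run w j = some c' → c.pos - a ≤ c'.pos ∧ c'.pos ≤ c.pos + b
  lo : ∃ j c', M.run w j = some c' ∧ c'.pos = c.pos - a
  hi : ∃ j c', M.run w j = some c' ∧ c'.pos = c.pos + b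
  tot : a + b + fr + 1 = n
  lL : L.length ≤ a
  lR : R.length ≤ w.length + b + 1

theorem SimInv.head {M w n k c L R a b fr} (h : SimInv M w n k c L R a b fr) :
    c.tape c.pos = R.headD none := by
  have := h.right 0
  simp at this
  rw [this]
  cases R <;> simp

theorem run_succ {M : TM} {w k c c'} (h : M.run w k = some c) (hs : M.stepCfg c = some c') :
    M.run w (k + 1) = some c' := by
  simp [TM.run, h, hs]

theorem run_after {M : TM} {w k c} (h : M.run w k = some c) (hs : M.stepCfg c = none) :
    ∀ j, M.run w (k + 1 + j) = none := by
  intro j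
  induction j with
  | zero => simp [TM.run, h, hs]
  | succ j ih => rw [← Nat.add_assoc, TM.run, ih]; rfl

theorem SimInv.step_right {M w n k c L R a b fr b' fr' q' z} (h : SimInv M w n k c L R a b fr)
    (ht : M.trans c.q (c.tape c.pos) = some (q', z, true)) (hc : Cnt b fr b' fr') :
    SimInv M w n (k + 1) ⟨q', Function.update c.tape c.pos z, c.pos + 1⟩ (z :: L) R.tail (a + 1) b' fr' := by
  have hs : M.stepCfg c = some ⟨q', Function.update c.tape c.pos z, c.pos + 1⟩ := by
    simp [TM.stepCfg, ht]
  have hr := run_succ h.run hs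
  have htot := h.tot
  refine ⟨hr, ?_, ?_, ?_, ?_, ?_, ?_, ?_, ?_⟩
  · intro i
    have := h.right (i + 1)
    dsimp only
    rw [Function.update_of_ne (by omega)]
    have e : c.pos + 1 + (i : ℤ) = c.pos + ((i + 1 : ℕ) : ℤ) := by push_cast; ring
    simp only [e, this]
    cases R <;> simp
  · intro i
    cases i with
    | zero => simp
    | succ i =>
      dsimp only
      rw [Function.update_of_ne (by push_cast; omega)]
      have e : c.pos + 1 - 1 - ((i + 1 : ℕ) : ℤ) = c.pos - 1 - (i : ℤ) := by push_cast; ring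
      simp only [e, h.left i]
      simp
  · intro j c' hj hj'
    rcases Nat.lt_or_ge k j with hk | hk
    · have : j = k + 1 := by omega
      subst this
      rw [hr] at hj'
      cases hj'
      simp only []
      omega
    · have := h.rng j c' hk hj'
      simp only []
      rcases hc with ⟨h1, h2⟩ | ⟨h1, h2, h3⟩ <;> omega
  · obtain ⟨j, c', h1, h2⟩ := h.lo
    exact ⟨j, c', h1, by simp only []; omega⟩
  · rcases hc with ⟨h1, h2⟩ | ⟨h1, h2, h3⟩
    · obtain ⟨j, c', h3, h4⟩ := h.hi
      exact ⟨j, c', h3, by simp only []; omega⟩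
    · exact ⟨k + 1, _, hr, by simp only []; omega⟩
  · rcases hc with ⟨h1, h2⟩ | ⟨h1, h2, h3⟩ <;> omega
  · have := h.lL; simp; omega
  · have := h.lR
    simp only [List.length_tail]
    rcases hc with ⟨h1, h2⟩ | ⟨h1, h2, h3⟩ <;> omega

theorem SimInv.step_left {M w n k c L R a b fr a' fr' q' z} (h : SimInv M w n k c L R a b fr)
    (ht : M.trans c.q (c.tape c.pos) = some (q', z, false)) (hc : Cnt a fr a' fr') :
    SimInv M w n (k + 1) ⟨q', Function.update c.tape c.pos z, c.pos - 1⟩ L.tail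
      (L.headD none :: z :: R.tail) a' (b + 1) fr' := by
  have hs : M.stepCfg c = some ⟨q', Function.update c.tape c.pos z, c.pos - 1⟩ := by
    simp [TM.stepCfg, ht]
  have hr := run_succ h.run hs
  have htot := h.tot
  refine ⟨hr, ?_, ?_, ?_, ?_, ?_, ?_, ?_, ?_⟩
  · intro i
    match i with
    | 0 =>
      dsimp only
      rw [Function.update_of_ne (by simp)]
      have := h.left 0
      simp at this ⊢
      rw [this]
      cases L <;> simp
    | 1 => simp
    | i + 2 =>
      have := h.right (i + 1)
      dsimp only
      rw [Function.update_of_ne (by push_cast; omega)]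
      have e : c.pos - 1 + ((i + 2 : ℕ) : ℤ) = c.pos + ((i + 1 : ℕ) : ℤ) := by push_cast; ring
      simp only [e, this]
      cases R <;> simp
  · intro i
    have := h.left (i + 1)
    dsimp only
    rw [Function.update_of_ne (by omega)]
    have e : c.pos - 1 - 1 - (i : ℤ) = c.pos - 1 - ((i + 1 : ℕ) : ℤ) := by push_cast; ring
    simp only [e, this]
    cases L <;> simp
  · intro j c' hj hj'
    rcases Nat.lt_or_ge k j with hk | hk
    · have : j = k + 1 := by omega
      subst this
      rw [hr] at hj'
      cases hj'
      simp only []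
      omega
    · have := h.rng j c' hk hj'
      simp only []
      rcases hc with ⟨h1, h2⟩ | ⟨h1, h2, h3⟩ <;> omega
  · rcases hc with ⟨h1, h2⟩ | ⟨h1, h2, h3⟩
    · obtain ⟨j, c', h3, h4⟩ := h.lo
      exact ⟨j, c', h3, by simp only []; omega⟩
    · exact ⟨k + 1, _, hr, by simp only []; omega⟩
  · obtain ⟨j, c', h1, h2⟩ := h.hi
    exact ⟨j, c', h1, by simp only []; omega⟩
  · rcases hc with ⟨h1, h2⟩ | ⟨h1, h2, h3⟩ <;> omega
  · have := h.lL
    simp only [List.length_tail]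
    rcases hc with ⟨h1, h2⟩ | ⟨h1, h2, h3⟩ <;> omega
  · have := h.lR; simp; omega

theorem SimInv.over_right {M w n k c L R a q' z} (h : SimInv M w n k c L R a 0 0)
    (ht : M.trans c.q (c.tape c.pos) = some (q', z, true)) : ¬ M.RunsInSpace w n := by
  have hs : M.stepCfg c = some ⟨q', Function.update c.tape c.pos z, c.pos + 1⟩ := by
    simp [TM.stepCfg, ht]
  have hr := run_succ h.run hs
  rintro ⟨lo, hlo⟩
  obtain ⟨j, c', h1, h2⟩ := h.lo
  have h3 := hlo _ _ h1
  have h4 := hlo _ _ hr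
  have := h.tot
  simp only at h4
  omega

theorem SimInv.over_left {M w n k c L R b q' z} (h : SimInv M w n k c L R 0 b 0)
    (ht : M.trans c.q (c.tape c.pos) = some (q', z, false)) : ¬ M.RunsInSpace w n := by
  have hs : M.stepCfg c = some ⟨q', Function.update c.tape c.pos z, c.pos - 1⟩ := by
    simp [TM.stepCfg, ht]
  have hr := run_succ h.run hs
  rintro ⟨lo, hlo⟩
  obtain ⟨j, c', h1, h2⟩ := h.hi
  have h3 := hlo _ _ h1
  have h4 := hlo _ _ hr
  have := h.tot
  simp only at h4
  omega

theorem accepts_iff {M : TM} {w k c} (h : M.run w k = some c) (hs : M.stepCfg c = none) :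
    M.Accepts w ↔ c.q = M.qacc := by
  constructor
  · rintro ⟨j, c', h1, h2, h3⟩
    rcases Nat.lt_trichotomy j k with hj | hj | hj
    · obtain ⟨d, rfl⟩ : ∃ d, k = j + 1 + d := ⟨k - j - 1, by omega⟩
      rw [run_after h1 h2] at h; cases h
    · subst hj
      rw [h] at h1; cases h1; exact h3
    · obtain ⟨d, rfl⟩ : ∃ d, j = k + 1 + d := ⟨j - k - 1, by omega⟩
      rw [run_after h hs] at h1; cases h1
  · intro hq
    exact ⟨k, c, h, hs, hq⟩

theorem SimInv.space {M w n k c L R a b fr} (h : SimInv M w n k c L R a b fr)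
    (hs : M.stepCfg c = none) : M.RunsInSpace w n := by
  refine ⟨c.pos - a, ?_⟩
  intro j c' hj
  have htot := h.tot
  rcases Nat.lt_or_ge k j with hk | hk
  · obtain ⟨d, rfl⟩ : ∃ d, j = k + 1 + d := ⟨j - k - 1, by omega⟩
    rw [run_after h.run hs] at hj; cases hj
  · have := h.rng j c' hk hj
    omega

/-! ### The main loop -/

def Outc (A : Prop) (c : List Prog × List (List Bool)) : Prop :=
  (c.1 = [] ∧ A) ∨ ((∃ K', c.1 = Prog.rej :: K') ∧ ¬ A)

theorem cR_length (R : List TapeSym) : (cR R).length = 2 * R.length := by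
  induction R with
  | nil => rfl
  | cons a R ih =>
    have : cR (a :: R) = encodeSym a ++ cR R := rfl
    rw [this, List.length_append, ih]
    rcases a with _ | _ <;> simp [encodeSym] <;> omega

theorem cL_length (R : List TapeSym) : (cL R).length = 2 * R.length := by
  induction R with
  | nil => rfl
  | cons a R ih =>
    have : cL (a :: R) = (encodeSym a).reverse ++ cL R := rfl
    rw [this, List.length_append, ih]
    rcases a with _ | _ <;> simp [encodeSym] <;> omega

theorem SimInv.sz_le {M w n k c L R a b fr} (h : SimInv M w n k c L R a b fr) :
    sz (SS M c.q L R a b fr [true]) ≤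
      (rows M).flatten.length + 2 * M.nstates + 3 * n + 2 * w.length + 3 := by
  have h1 := h.lL
  have h2 := h.lR
  have h3 := h.tot
  have h4 := c.q.2
  have h5 := M.qacc.2
  simp only [sz, SS, List.map_cons, List.map_nil, List.sum_cons, List.sum_nil, cR_length, cL_length,
    List.length_replicate, List.length_nil, List.length_cons]
  omega

theorem unt_start (p : Prog) (K : List Prog) (M q L R a b fr) :
    sstep (Prog.unt 10 p :: K, SS M q L R a b fr [true]) =
      some (p :: Prog.unt 10 p :: K, SS M q L R a b fr []) := rfl

theorem main_loop {M : TM} {w : List Bool} {n B N : ℕ} {cN : TMCfg M}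
    (hN : M.run w N = some cN) (hNs : M.stepCfg cN = none)
    (hB : 11 * (rows M).flatten.length + 102 * M.nstates + 3 * n + 2 * w.length + 310 ≤ B) :
    ∀ (d k : ℕ) (c : TMCfg M) (L R : List TapeSym) (a b fr : ℕ), d = N - k → k ≤ N →
      SimInv M w n k c L R a b fr →
      ∃ t c', Rch sstep (fun c => sz c.2 ≤ B) t ([Prog.unt 10 bodyP], SS M c.q L R a b fr [true]) c' ∧
        Outc (M.Accepts w ∧ M.RunsInSpace w n) c' := by
  intro d
  induction d using Nat.strong_induction_on with
  | _ d ih =>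
  intro k c L R a b fr hd hk h
  have hsz := h.sz_le
  have hTB : TB M = 10 * (rows M).flatten.length + 100 * M.nstates + 300 := rfl
  have hst := unt_start bodyP [] M c.q L R a b fr
  have hhead := h.head
  have fin_rej : ¬ (M.Accepts w ∧ M.RunsInSpace w n) →
      Wp (TB M) bodyP (SS M c.q L R a b fr []) RejQ →
      ∃ t c', Rch sstep (fun c => sz c.2 ≤ B) t ([Prog.unt 10 bodyP], SS M c.q L R a b fr [true]) c' ∧
        Outc (M.Accepts w ∧ M.RunsInSpace w n) c' := by
    intro hn hw
    obtain ⟨c', h1, h2⟩ := hw [Prog.unt 10 bodyP]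
    exact ⟨_, c', rch_sz (Rch.step _ _ _ _ trivial hst h1) (by simp only; omega), Or.inr ⟨h2, hn⟩⟩
  rcases ht : M.trans c.q (R.headD none) with _ | ⟨q', z, dir⟩
  · have hs : M.stepCfg c = none := by simp only [TM.stepCfg, hhead, ht]
    by_cases hq : c.q = M.qacc
    · obtain ⟨⟨K', s'⟩, h1, h2, h3⟩ := body_acc M c.q L R a b fr ht hq [Prog.unt 10 bodyP]
      simp only at h2 h3
      subst h2
      have h4 : sstep ([Prog.unt 10 bodyP], s') = some ([], s') := by
        simp only [sstep, popStep, h3]; rfl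
      exact ⟨_, _, rch_sz ((Rch.step _ _ _ _ trivial hst h1).trans (Rch.one trivial h4 trivial))
        (by simp only; omega), Or.inl ⟨rfl, (accepts_iff h.run hs).2 hq, h.space hs⟩⟩
    · exact fin_rej (fun h' => hq ((accepts_iff h.run hs).1 h'.1)) (body_rej M c.q L R a b fr ht hq)
  · have ht' : M.trans c.q (c.tape c.pos) = some (q', z, dir) := by rw [hhead, ht]
    have hkN : k < N := by
      rcases Nat.lt_or_ge k N with h' | h'
      · exact h'
      · have : k = N := by omega
        subst this
        have := h.run
        rw [hN] at this
        cases this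
        simp [TM.stepCfg, ht'] at hNs
    have go : ∀ (q' : Fin M.nstates) (tp : ℤ → TapeSym) (ps : ℤ) (L' R' : List TapeSym) (a' b' fr' : ℕ),
        Ex (TB M) bodyP (SS M c.q L R a b fr []) (SS M q' L' R' a' b' fr' [true]) →
        SimInv M w n (k + 1) ⟨q', tp, ps⟩ L' R' a' b' fr' →
        ∃ t c', Rch sstep (fun c => sz c.2 ≤ B) t ([Prog.unt 10 bodyP], SS M c.q L R a b fr [true]) c' ∧
          Outc (M.Accepts w ∧ M.RunsInSpace w n) c' := by
      intro q' tp ps L' R' a' b' fr' h1 h2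
      obtain ⟨t, c', h3, h4⟩ := ih (N - (k + 1)) (by omega) (k + 1) _ L' R' a' b' fr' rfl (by omega) h2
      have h5 : Rch sstep (fun c => sz c.2 ≤ B) _ _ _ :=
        rch_sz (Rch.step _ _ _ _ trivial hst (h1 [Prog.unt 10 bodyP])) (by simp only; omega)
      exact ⟨_, c', h5.trans h3, h4⟩
    cases dir with
    | true =>
      by_cases hbf : b = 0 ∧ fr = 0
      · obtain ⟨rfl, rfl⟩ := hbf
        exact fin_rej (fun h' => h.over_right ht' h'.2) (body_right_rej M c.q q' z L R a ht)
      · obtain ⟨b', fr', hc⟩ : ∃ b' fr', Cnt b fr b' fr' := by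
          by_cases hb : b = 0
          · exact ⟨0, fr - 1, Or.inr ⟨hb, rfl, by omega⟩⟩
          · exact ⟨b - 1, fr, Or.inl ⟨by omega, rfl⟩⟩
        exact go _ _ _ _ _ _ _ _ (body_right M c.q q' z L R a b fr b' fr' ht hc) (h.step_right ht' hc)
    | false =>
      by_cases hbf : a = 0 ∧ fr = 0
      · obtain ⟨rfl, rfl⟩ := hbf
        exact fin_rej (fun h' => h.over_left ht' h'.2) (body_left_rej M c.q q' z L R b ht)
      · obtain ⟨a', fr', hc⟩ : ∃ a' fr', Cnt a fr a' fr' := by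
          by_cases hb : a = 0
          · exact ⟨0, fr - 1, Or.inr ⟨hb, rfl, by omega⟩⟩
          · exact ⟨a - 1, fr, Or.inl ⟨by omega, rfl⟩⟩
        exact go _ _ _ _ _ _ _ _ (body_left M c.q q' z L R a b fr a' fr' ht hc) (h.step_left ht' hc)

theorem SimInv.init (M : TM) (w : List Bool) (n : ℕ) :
    SimInv M w (n + 1) 0 (M.initCfg w) [] (w.map some) 0 0 n := by
  refine ⟨rfl, ?_, ?_, ?_, ⟨0, _, rfl, by simp⟩, ⟨0, _, rfl, by simp⟩, by omega, by simp, by simp⟩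
  · intro i
    have : ¬ ((i : ℤ) < 0) := by omega
    simp only [TM.initCfg, zero_add, this, if_false, Int.toNat_natCast, List.getD_eq_getElem?_getD,
      List.getElem?_map]
    cases w[i]? <;> simp
  · intro i
    have : ((0 : ℤ) - 1 - i < 0) := by omega
    simp only [TM.initCfg, this, if_true]
    simp
  · intro j c' hj hr
    have : j = 0 := by omega
    subst this
    simp only [TM.run, Option.some.injEq] at hr
    subst hr
    simp

/-! ### Parsing the input -/

def parseP : Prog :=
  Prog.seq (Prog.unt 0 (Prog.push 3 true)) (Prog.seq (Prog.unt 0 (Prog.push 2 true))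
  (Prog.seq (Prog.unt 0 (Prog.push 9 true)) (Prog.seq (Prog.loop 3 Prog.skip moveRow)
  (Prog.seq (Prog.unt 0 (Prog.push 3 true)) (Prog.seq (Prog.loop 3 Prog.skip (moveBit 0 6))
  (Prog.seq (Prog.loop 6 (Prog.seq (Prog.push 5 false) (Prog.push 5 true))
    (Prog.seq (Prog.push 5 true) (Prog.push 5 true)))
  (Prog.unt 0 (Prog.push 8 true))))))))

def psim : Prog :=
  Prog.seq parseP (Prog.seq (Prog.pop 8 Prog.rej Prog.skip Prog.skip)
    (Prog.seq (mv 1 0) (Prog.seq (Prog.push 10 true) (Prog.unt 10 bodyP))))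

theorem encodeInput_eq (M : TM) (w : List Bool) (n : ℕ) :
    encodeInput M w n = encodeNatU M.nstates ++ (encodeNatU M.q0.val ++ (encodeNatU M.qacc.val ++
      ((rows M).flatten ++ (encodeNatU w.length ++ (w ++ (encodeNatU n ++ [])))))) := by
  simp [encodeInput, encodeTM_rows]

theorem encodeInput_length (M : TM) (w : List Bool) (n : ℕ) :
    (encodeInput M w n).length = M.nstates + M.q0.val + M.qacc.val + (rows M).flatten.length +
      2 * w.length + n + 5 := by
  rw [encodeInput_eq]
  simp only [encodeNatU, List.length_append, List.length_replicate, List.length_cons, List.length_nil]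
  omega

theorem ex_rows (M : TM) (y r2 r9 : List Bool) :
    Ex (2 * (rows M).flatten.length + 75 * M.nstates + 1) (Prog.loop 3 Prog.skip moveRow)
      [(rows M).flatten ++ y, [], r2, un M.nstates, [], [], [], [], [], r9, []]
      [y, (rows M).flatten.reverse, r2, [], [], [], [], [], [], r9, []] := by
  have h1 := Ex.loopP (i := 3) (pf := Prog.skip) (pt := moveRow) (un M.nstates)
    (fun c x => [((rows M).drop c.length).flatten ++ y, ((rows M).take c.length).flatten.reverse, r2, x,
      [], [], [], [], [], r9, []])
    (fun c x => 2 * ((rows M).drop c.length).flatten.length + 75 * x.length + 1)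
    (fun _ _ => rfl) (by simp) (by
      intro c b x hx
      have hb : b = true := by
        have : b ∈ un M.nstates := by rw [hx]; simp
        exact List.eq_of_mem_replicate this
      subst hb
      have hl : c.length < M.nstates := by
        have := congrArg List.length hx
        simp at this; omega
      have hr := ex_moveRow M ⟨c.length, hl⟩ (((rows M).drop (c.length + 1)).flatten ++ y)
        ((rows M).take c.length).flatten.reverse [r2, x, [], [], [], [], [], r9, []]
      have hd := rows_drop M ⟨c.length, hl⟩
      have ht := rows_take M ⟨c.length, hl⟩
      simp only at hd ht
      rw [← List.append_assoc, ← hd, ← List.reverse_append, ← ht] at hr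
      refine ⟨_, hr, ?_⟩
      simp only [List.length_cons]
      have := congrArg List.length hd
      rw [List.length_append] at this
      omega)
  have e2 : (rows M).drop M.nstates = [] := by
    rw [List.drop_eq_nil_iff]; simp [rows_length]
  have e3 : (rows M).take M.nstates = rows M := by
    rw [List.take_of_length_le]; simp [rows_length]
  simpa [e2, e3] using h1

theorem ex_w1 (w y r1 r2 r9 : List Bool) :
    Ex (3 * w.length + 1) (Prog.loop 3 Prog.skip (moveBit 0 6))
      [w ++ y, r1, r2, un w.length, [], [], [], [], [], r9, []]
      [y, r1, r2, [], [], [], w.reverse, [], [], r9, []] := by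
  have h1 := Ex.loop (i := 3) (t := 2) (pf := Prog.skip) (pt := moveBit 0 6) (un w.length)
    (fun c x => [w.drop c.length ++ y, r1, r2, x, [], [], (w.take c.length).reverse, [], [], r9, []])
    (fun _ _ => rfl) (by
      intro c b x hx
      have hb : b = true := by
        have : b ∈ un w.length := by rw [hx]; simp
        exact List.eq_of_mem_replicate this
      subst hb
      have hl : c.length < w.length := by
        have := congrArg List.length hx
        simp at this; omega
      have hd : w.drop c.length = w[c.length] :: w.drop (c.length + 1) := List.drop_eq_getElem_cons hl
      have ht : (w.take (c.length + 1)).reverse = w[c.length] :: (w.take c.length).reverse := by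
        rw [List.take_succ_eq_append_getElem hl]; simp
      simp only [List.length_cons, hd, ht]
      generalize w[c.length] = b
      refine Ex.pop_cons (b := b) rfl ?_
      cases b <;> exact Ex.push _ rfl)
  simpa using h1

theorem ex_w2 (w y r1 r2 r9 : List Bool) :
    Ex (4 * w.length + 1) (Prog.loop 6 (Prog.seq (Prog.push 5 false) (Prog.push 5 true))
        (Prog.seq (Prog.push 5 true) (Prog.push 5 true)))
      [y, r1, r2, [], [], [], w.reverse, [], [], r9, []]
      [y, r1, r2, [], [], cR (w.map some), [], [], [], r9, []] := by
  have h1 := Ex.loop (i := 6) (t := 3) (pf := Prog.seq (Prog.push 5 false) (Prog.push 5 true))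
    (pt := Prog.seq (Prog.push 5 true) (Prog.push 5 true)) w.reverse
    (fun c x => [y, r1, r2, [], [], cR (c.map some), x, [], [], r9, []])
    (fun _ _ => rfl) (by
      intro c b x _
      cases b <;> exact (Ex.push _ rfl).seq (Ex.push _ rfl))
  simpa [cR] using h1

theorem ex_parse (M : TM) (w : List Bool) (n : ℕ) :
    Ex (80 * (encodeInput M w n).length + 50) parseP (encodeInput M w n :: List.replicate 10 [])
      [[], (rows M).flatten.reverse, un M.q0.val, [], [], cR (w.map some), [], [], un n, un M.qacc.val, []] := by
  have hl := encodeInput_length M w n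
  have e := encodeInput_eq M w n
  set y7 := encodeNatU n ++ []
  set y6 := w ++ y7
  set y5 := encodeNatU w.length ++ y6
  set y4 := (rows M).flatten ++ y5
  set y3 := encodeNatU M.qacc.val ++ y4
  set y2 := encodeNatU M.q0.val ++ y3
  have h1 := Ex.unt (i := 0) (p := Prog.push 3 true) (t := 1) M.nstates y2
      (fun j x => [x, [], [], un j, [], [], [], [], [], [], []]) (fun _ _ => rfl) (fun _ _ _ => rfl)
      (fun j x => Ex.push _ rfl)
  have h2 := Ex.unt (i := 0) (p := Prog.push 2 true) (t := 1) M.q0.val y3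
      (fun j x => [x, [], un j, un M.nstates, [], [], [], [], [], [], []]) (fun _ _ => rfl) (fun _ _ _ => rfl)
      (fun j x => Ex.push _ rfl)
  have h3 := Ex.unt (i := 0) (p := Prog.push 9 true) (t := 1) M.qacc.val y4
      (fun j x => [x, [], un M.q0.val, un M.nstates, [], [], [], [], [], un j, []]) (fun _ _ => rfl) (fun _ _ _ => rfl)
      (fun j x => Ex.push _ rfl)
  have h4 := ex_rows M y5 (un M.q0.val) (un M.qacc.val)
  have h5 := Ex.unt (i := 0) (p := Prog.push 3 true) (t := 1) w.length y6
      (fun j x => [x, (rows M).flatten.reverse, un M.q0.val, un j, [], [], [], [], [], un M.qacc.val, []])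
      (fun _ _ => rfl) (fun _ _ _ => rfl) (fun j x => Ex.push _ rfl)
  have h6 := ex_w1 w y7 (rows M).flatten.reverse (un M.q0.val) (un M.qacc.val)
  have h7 := ex_w2 w y7 (rows M).flatten.reverse (un M.q0.val) (un M.qacc.val)
  have h8 := Ex.unt (i := 0) (p := Prog.push 8 true) (t := 1) n []
      (fun j x => [x, (rows M).flatten.reverse, un M.q0.val, [], [], cR (w.map some), [], [], un j,
        un M.qacc.val, []])
      (fun _ _ => rfl) (fun _ _ _ => rfl) (fun j x => Ex.push _ rfl)
  have h := h1.seq (h2.seq (h3.seq (h4.seq (h5.seq (h6.seq (h7.seq h8))))))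
  rw [e]
  refine h.mono ?_
  rw [← e]
  omega

theorem psim_run (M : TM) (w : List Bool) (n : ℕ) (hM : M.Halts w) :
    ∃ t c', Rch sstep (fun c => sz c.2 ≤ 500 * (encodeInput M w n).length + 500) t
      ([psim], encodeInput M w n :: List.replicate 10 []) c' ∧
      Outc (M.Accepts w ∧ M.RunsInSpace w n) c' := by
  have hl := encodeInput_length M w n
  have hp := ex_parse M w n
  have hsz : sz (encodeInput M w n :: List.replicate 10 []) = (encodeInput M w n).length := by
    simp [sz]
  set m := (encodeInput M w n).length
  set s0 := encodeInput M w n :: List.replicate 10 []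
  obtain ⟨N, cN, hN, hNs⟩ := hM
  have hst : ∀ p q K, sstep (Prog.seq p q :: K, s0) = some (p :: q :: K, s0) := fun _ _ _ => rfl
  have a1 := Rch.step _ _ _ _ trivial (hst parseP (Prog.seq (Prog.pop 8 Prog.rej Prog.skip Prog.skip)
    (Prog.seq (mv 1 0) (Prog.seq (Prog.push 10 true) (Prog.unt 10 bodyP)))) []) (hp _)
  cases n with
  | zero =>
    have a2 : Wp _ (Prog.seq (Prog.pop 8 Prog.rej Prog.skip Prog.skip)
        (Prog.seq (mv 1 0) (Prog.seq (Prog.push 10 true) (Prog.unt 10 bodyP))))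
        [[], (rows M).flatten.reverse, un M.q0.val, [], [], cR (w.map some), [], [], un 0, un M.qacc.val, []] RejQ :=
      Wp.seq_rej (Wp.pop_nil (i := 8) rfl Wp.rej)
    obtain ⟨c', a3, a4⟩ := a2 []
    refine ⟨_, c', rch_sz (a1.trans a3) (by rw [hsz]; omega), Or.inr ⟨a4, ?_⟩⟩
    rintro ⟨_, lo, hlo⟩
    have := hlo 0 _ rfl
    omega
  | succ n =>
    have b1 : Ex 2 (Prog.pop 8 Prog.rej Prog.skip Prog.skip)
        [[], (rows M).flatten.reverse, un M.q0.val, [], [], cR (w.map some), [], [], un (n + 1), un M.qacc.val, []]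
        [[], (rows M).flatten.reverse, un M.q0.val, [], [], cR (w.map some), [], [], un n, un M.qacc.val, []] :=
      Ex.pop_cons (b := true) (x := un n) rfl (Ex.skip _)
    have b2 := Ex.loop (i := 1) (t := 1) (pf := Prog.push 0 false) (pt := Prog.push 0 true)
      (rows M).flatten.reverse
      (fun c x => [c, x, un M.q0.val, [], [], cR (w.map some), [], [], un n, un M.qacc.val, []])
      (fun _ _ => rfl) (by
        intro c b x _
        cases b <;> exact Ex.push _ rfl)
    rw [List.reverse_reverse] at b2
    have b3 : Ex 1 (Prog.push 10 true)
      [(rows M).flatten, [], un M.q0.val, [], [], cR (w.map some), [], [], un n, un M.qacc.val, []]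
      (SS M M.q0 [] (w.map some) 0 0 n [true]) := Ex.push _ rfl
    have hst2 : ∀ p q K s, sstep (Prog.seq p q :: K, s) = some (p :: q :: K, s) := fun _ _ _ _ => rfl
    have a2 := Rch.step _ _ _ _ trivial (hst2 (Prog.pop 8 Prog.rej Prog.skip Prog.skip)
      (Prog.seq (mv 1 0) (Prog.seq (Prog.push 10 true) (Prog.unt 10 bodyP))) [] _)
      ((b1 _).trans (Rch.step _ _ _ _ trivial (hst2 _ _ _ _) ((b2 _).trans
      (Rch.step _ _ _ _ trivial (hst2 _ _ _ _) (b3 _)))))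
    obtain ⟨t, c', h1, h2⟩ := main_loop (B := 500 * m + 500) hN hNs (n := n + 1) (by omega)
      (N - 0) 0 (M.initCfg w) [] (w.map some) 0 0 n rfl (by omega) (SimInv.init M w n)
    have a3 : Rch sstep (fun c => sz c.2 ≤ 500 * m + 500) _ _ _ :=
      rch_sz (a1.trans a2) (by simp only [hsz, List.length_reverse]; omega)
    exact ⟨_, c', a3.trans h1, h2⟩

/-! ## Putting everything together -/

theorem W_write (U : TM) (x : List Bool) (H : ℤ) (hH : (x.length : ℤ) ≤ H) (i : ℕ) (hi : i ≤ x.length) :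
    Rch (W U x).stepCfg (fun c => -1 ≤ c.pos ∧ c.pos ≤ H) i ((W U x).initCfg [])
      ⟨Fin.natAdd _ ⟨i, by omega⟩, tapeOf (none :: (x.take i).map some), i⟩ := by
  induction i with
  | zero =>
    have : (W U x).initCfg [] = ⟨Fin.natAdd _ ⟨0, by omega⟩, tapeOf (none :: (x.take 0).map some), (0 : ℕ)⟩ := by
      have h := init_tape [] 0
      simp only [lay, List.map_nil, List.nil_append, List.replicate_zero] at h
      have h2 := tapeOf_pad [none]
      simp only [TM.initCfg, W, h]
      simp only [List.cons_append, List.nil_append] at h2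
      simp only [List.take_zero, List.map_nil, ← h2]
      rfl
    rw [this]
    exact Rch.refl _ _ (by simp; omega)
  | succ i ih =>
    refine (ih (by omega)).trans (Rch.one ⟨by simp only; omega, by simp only; omega⟩ ?_
      ⟨by simp only; omega, by simp only; omega⟩)
    have hlen : ((none :: (x.take i).map some : List TapeSym).length : ℤ) - 1 = i := by
      simp; omega
    have h1 := tapeOf_read (none :: (x.take i).map some) [] none
    have h2 := tapeOf_write (none :: (x.take i).map some) [] none (some x[i])
    rw [tapeOf_pad, hlen] at h1
    rw [tapeOf_pad, hlen] at h2
    have h3 := Wtrans_none U x ⟨i, by omega⟩ (by simp only; omega)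
    have e : none :: (x.take i).map some ++ [some x[i]] = none :: (x.take (i + 1)).map some := by
      rw [List.take_succ_eq_append_getElem (by omega)]; simp only [List.map_append, List.map_cons, List.map_nil, List.cons_append]
    rw [e] at h2
    simp only [TM.stepCfg, h1]
    rw [show (W U x).trans = Wtrans U x from rfl, h3]
    simp only [h2, if_true, Nat.cast_add, Nat.cast_one]

theorem W_enter (U : TM) (x : List Bool) :
    (W U x).stepCfg ⟨Fin.natAdd _ ⟨x.length, by omega⟩, tapeOf (none :: (x.take x.length).map some), x.length⟩
      = some ⟨Fin.castAdd _ U.q0, tapeOf (none :: x.map some), (x.length : ℤ) - 1⟩ := by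
  have hlen : ((none :: x.map some : List TapeSym).length : ℤ) - 1 = x.length := by simp
  have h1 := tapeOf_read (none :: x.map some) [] none
  have h2 := tapeOf_write (none :: x.map some) [] none none
  rw [tapeOf_pad, hlen] at h1
  rw [tapeOf_pad, hlen] at h2
  have h3 := Wtrans_last U x ⟨x.length, by omega⟩ (by simp)
  simp only [List.take_length, TM.stepCfg, h1]
  rw [show (W U x).trans = Wtrans U x from rfl, h3]
  simp [h2]

def emb (U : TM) (x : List Bool) (c : TMCfg U) : TMCfg (W U x) := ⟨Fin.castAdd _ c.q, c.tape, c.pos⟩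

theorem W_step (U : TM) (x : List Bool) (c : TMCfg U) :
    (W U x).stepCfg (emb U x c) = (U.stepCfg c).map (emb U x) := by
  simp only [TM.stepCfg, emb]
  rw [show (W U x).trans = Wtrans U x from rfl, Wtrans_left]
  rcases U.trans c.q (c.tape c.pos) with _ | ⟨q', z, d⟩ <;> rfl

theorem W_embed (U : TM) (x : List Bool) (lo hi : ℤ) {t : ℕ} {c c' : TMCfg U}
    (h : Rch U.stepCfg (fun c => lo ≤ c.pos ∧ c.pos ≤ hi) t c c') :
    Rch (W U x).stepCfg (fun c => lo ≤ c.pos ∧ c.pos ≤ hi) t (emb U x c) (emb U x c') := by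
  have := (Rch.sim (f' := (W U x).stepCfg) (P' := fun c => lo ≤ c.pos ∧ c.pos ≤ hi) (emb U x)
    (fun _ => True) 1 (fun c _ h => h)
    (fun c c' _ hP hs hP' => ⟨trivial, Rch.one hP (by rw [W_step, hs]; rfl) hP'⟩) h trivial).2
  simpa using this

theorem zl_eq (q : TS) (l r : List TapeSym) (hl : l ≠ []) :
    zl q l r = ⟨q, tapeOf (l.reverse ++ r), (l.length : ℤ) - 2⟩ := by
  cases l with
  | nil => exact absurd rfl hl
  | cons y l =>
    simp only [zl, zc, List.reverse_cons, List.append_assoc, List.cons_append, List.nil_append,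
      List.length_cons]
    congr 1
    push_cast; ring

theorem outc_stuck {A : Prop} {c : List Prog × List (List Bool)} (h : Outc A c) (l r : List TapeSym) :
    gstep (dl 11) (zc (startS 11 c.1) l r) = none := by
  rcases h with ⟨h, _⟩ | ⟨⟨K', h⟩, _⟩ <;> rw [h] <;> simp [gstep, zc, startS, idx, dl, dact]

/-- behaviour of the constructed machine on the empty word -/
theorem W_run (U : TM) (e : TS → Fin U.nstates)
    (hq0 : U.q0 = e (TS.ret [psim] 0)) (hqa : U.qacc = e (TS.scan [] 0))
    (hinj : Set.InjOn e (stateSet psim 11))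
    (htr : ∀ q ∈ stateSet psim 11, ∀ y, U.trans (e q) y = (dl 11 q y).map (fun x => (e x.1, x.2.1, x.2.2)))
    (A : Prop) (x : List Bool) (B : ℕ) (hB : x.length ≤ B)
    (h : ∃ t c', Rch sstep (fun c => sz c.2 ≤ B) t ([psim], x :: List.replicate 10 []) c' ∧ Outc A c') :
    ∃ k c, (W U x).run [] k = some c ∧ (W U x).stepCfg c = none ∧ (c.q = (W U x).qacc ↔ A) ∧
      (W U x).RunsInSpace [] (B + 14) := by
  obtain ⟨t, c', h1, h2⟩ := h
  have hst := outc_stuck h2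
  have hK : ([psim] : List Prog) ∈ conts psim := Or.inr (cl_self psim [])
  have hret : TS.ret [psim] 0 ∈ stateSet psim 11 := ⟨hK, by simp [TS.j], trivial⟩
  obtain ⟨-, a2⟩ := tr_run 11 B (by omega) h1 (by simp)
  have a1 := tr_ret 11 (B + 11 + 1) [psim] (x.map some).reverse (List.replicate 11 none) (by simp; omega)
  have hcount : (x.map some).reverse.count (none : TapeSym) = 0 := by
    rw [List.count_eq_zero]; simp
  have hlay : lay (x :: List.replicate 10 []) = (x.map some) ++ List.replicate 11 none := rfl
  rw [hcount, List.reverse_reverse, ← hlay] at a1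
  have a3 := a1.trans a2
  have hz : zl (TS.ret [psim] 0) ((x.map some).reverse ++ [none]) (List.replicate 11 none) =
      ⟨TS.ret [psim] 0, tapeOf (none :: x.map some), (x.length : ℤ) - 1⟩ := by
    rw [zl_eq _ _ _ (by simp), tapeOf_pads]
    simp
    ring
  rw [hz] at a3
  obtain ⟨b1, b2⟩ := tm_rch _ (stateSet psim 11)
    (fun q hq y q' z b hh => stateSet_closed psim 11 q hq y z q' b hh) U e htr _ _ a3 hret
  have b3 := tm_stuck _ _ U e htr b1 (hst _ _)
  have b4 := W_embed U x _ _ b2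
  have hH : (x.length : ℤ) ≤ ((B + 11 + 1 : ℕ) : ℤ) := by push_cast; omega
  have w1 := W_write U x _ hH x.length le_rfl
  have w2 := w1.trans (Rch.one w1.last (W_enter U x) (by
    have := b4.head
    exact this))
  rw [hq0] at w2
  have w3 := w2.trans b4
  have hstk : (W U x).stepCfg (emb U x ⟨e (zc (startS 11 c'.1) [none] (lay c'.2)).q,
      (zc (startS 11 c'.1) [none] (lay c'.2)).tape, (zc (startS 11 c'.1) [none] (lay c'.2)).pos⟩) = none := by
    rw [W_step, b3]; rfl
  obtain ⟨k, -, h5, h6⟩ := itr_of_rch _ w3 hstk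
  refine ⟨k, _, by rw [run_eq_itr]; exact h5, hstk, ?_, -1, ?_⟩
  · have hnil : TS.scan [] 0 ∈ stateSet psim 11 := startS_mem psim 11 [] (Or.inl rfl)
    have e1 : (Fin.castAdd (x.length + 1) (e (startS 11 c'.1)) = Fin.castAdd (x.length + 1) U.qacc) ↔
        startS 11 c'.1 = TS.scan [] 0 := by
      rw [hqa]
      constructor
      · intro h
        exact hinj b1 hnil (Fin.castAdd_injective _ _ h)
      · intro h; rw [h]
    refine e1.trans ?_
    rcases h2 with ⟨h, hA⟩ | ⟨⟨K', h⟩, hA⟩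
    · rw [h]; simp [startS, idx, hA]
    · rw [h]; simp [startS, hA]
  · intro j d hj
    rw [run_eq_itr] at hj
    have := h6 j d hj
    push_cast at this ⊢
    omega

theorem W_nonempty (U : TM) (x : List Bool) (b : Bool) (u : List Bool) :
    (W U x).stepCfg ((W U x).initCfg (b :: u)) = none := by
  have h := Wtrans_some U x 0 b
  simp only [TM.stepCfg, TM.initCfg]
  rw [show (W U x).trans = Wtrans U x from rfl, show (W U x).q0 = Fin.natAdd _ 0 from rfl]
  simp [h]

theorem RunsInSpace_mono {M : TM} {w s s'} (h : M.RunsInSpace w s) (hs : s ≤ s') : M.RunsInSpace w s' := by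
  obtain ⟨lo, h⟩ := h
  refine ⟨lo, fun n c hc => ?_⟩
  have := h n c hc
  omega

theorem space_bounded_tm_construction :
    ∃ (F : TM → List Bool → ℕ → TM) (q : Polynomial ℕ) (g : List Bool → List Bool),
      -- the construction is computable in polynomial time on encodings
      PolyTimeComputable g ∧
      (∀ (M : TM) (w : List Bool) (n : ℕ),
        g (encodeInput M w n) = encodeTM (F M w n)) ∧
      -- the size of M′ is polynomial in ‖M‖, |w| and n
      (∀ (M : TM) (w : List Bool) (n : ℕ),
        (F M w n).size ≤ Polynomial.eval (M.size + w.length + n) q) ∧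
      -- and, whenever M always halts:
      ∀ (M : TM), (∀ u : List Bool, M.Halts u) →
        ∀ (w : List Bool) (n : ℕ),
          -- M′ is ‖M′‖-space-bounded: it halts on every input in space ‖M′‖
          (∀ u : List Bool,
            (F M w n).Halts u ∧ (F M w n).RunsInSpace u (F M w n).size) ∧
          -- if M accepts w in space at most n, M′ accepts the empty input
          ((M.Accepts w ∧ M.RunsInSpace w n) → (F M w n).Accepts []) ∧
          -- otherwise M′ rejects the empty input
          (¬(M.Accepts w ∧ M.RunsInSpace w n) → (F M w n).Rejects []) := by
  obtain ⟨U, e, hN, hq0, hqa, hinj, htr⟩ := exists_tm 600 (dl 11) (stateSet psim 11)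
    (stateSet_finite psim 11) (TS.ret [psim] 0) (TS.scan [] 0)
    ⟨Or.inr (cl_self psim []), by simp [TS.j], trivial⟩
  have hm : ∀ (M : TM) (w : List Bool) (n : ℕ),
      (encodeInput M w n).length ≤ 2 * (M.size + w.length + n) + 2 := by
    intro M w n
    simp only [encodeInput, TM.size, encodeNatU, List.length_append, List.length_replicate,
      List.length_cons, List.length_nil]
    omega
  have hL : PB (fun m => 2 * m + 2) := ((PB.const 2).mul PB.id).add (PB.const 2)
  have hPB : PB (fun m => (2 * m + 2) + (constA U).length +
      (U.nstates + 1 + (2 * m + 2) + 7) * (2 * m + 2) + (constE U).length) :=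
    ((hL.add (PB.const _)).add ((((PB.const _).add hL).add (PB.const _)).mul hL)).add (PB.const _)
  obtain ⟨q, hq⟩ := hPB
  refine ⟨fun M w n => W U (encodeInput M w n), q, fun x => encodeTM (W U x), polyTime_g U,
    fun _ _ _ => rfl, ?_, ?_⟩
  · intro M w n
    refine le_trans ((size_W U _).1.trans ?_) (hq _)
    have := hm M w n
    dsimp only
    gcongr
  · intro M hM w n
    dsimp only
    set x := encodeInput M w n with hx
    have hsz := (size_W U x).2
    have hA : U.nstates ≤ (constA U).length := by
      simp only [constA, List.length_append, List.length_replicate]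
      omega
    have hx5 : 600 * x.length ≤ (U.nstates + 8) * x.length := Nat.mul_le_mul_right _ (by omega)
    obtain ⟨k, c, h1, h2, h3, h4⟩ := W_run U e hq0 hqa hinj htr (M.Accepts w ∧ M.RunsInSpace w n) x
      (500 * x.length + 500) (by omega) (psim_run M w n (hM w))
    refine ⟨?_, fun h => ⟨k, c, h1, h2, h3.2 h⟩, fun h => ⟨k, c, h1, h2, fun h' => h (h3.1 h')⟩⟩
    intro u
    cases u with
    | nil => exact ⟨⟨k, c, h1, h2⟩, RunsInSpace_mono h4 (by omega)⟩
    | cons b u =>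
      have h5 := W_nonempty U x b u
      refine ⟨⟨0, _, rfl, h5⟩, 0, ?_⟩
      intro j d hj
      cases j with
      | zero =>
        simp only [TM.run, Option.some.injEq] at hj
        subst hj
        dsimp only [TM.initCfg]
        omega
      | succ j =>
        have := run_after (M := W U x) (w := b :: u) (k := 0) rfl h5 j
        rw [show 0 + 1 + j = j + 1 by omega] at this
        rw [this] at hj
        cases hj
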